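/- Let b₁,…,b_L ∈ ℝ[x₁,…,xₙ], let f = (f₁,…,fₙ) be a vector of polynomials and g = (g_{ij}) an n×m matrix of polynomials, let Kᵢ = {x ∈ ℝⁿ : bᵢ(x) = 0 and (L_g bᵢ)_j(x) = 0 for all j = 1,…,m} for each i, and let ℬ = {x ∈ ℝⁿ : bᵢ(x) ≥ 0 for all i = 1,…,L}. Let M_S = {s₀ + Σ_{i=1}^L sᵢ·bᵢ : s₀,…,s_L SOS} and assume M_S is Archimedean, i.e. there exists an integer C ≥ 1 with C − Σ_{i=1}^n xᵢ² ∈ M_S. Then the following two statements are equivalent: (A) for every i = 1,…,L, L_f bᵢ(x) ≥ 0 for all x ∈ Kᵢ, and ℬ ≠ ∅; (B) Condition 1: for every i = 1,…,L there exist a natural number aᵢ ≥ 0, SOS polynomials s₁⁽ⁱ⁾, s₂⁽ⁱ⁾, and polynomials p₁₀⁽ⁱ⁾, p₂₀⁽ⁱ⁾, p₁ⱼ⁽ⁱ⁾, p₂ⱼ⁽ⁱ⁾ such that, with h_k⁽ⁱ⁾ = s_k⁽ⁱ⁾ + bᵢ·p_{k0}⁽ⁱ⁾ + Σ_{j=1}^m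 (L_g bᵢ)_j·p_{kj}⁽ⁱ⁾ for k = 1,2, the identity h₁⁽ⁱ⁾·(L_f bᵢ) − h₂⁽ⁱ⁾ − (L_f bᵢ)^{2aᵢ} = 0 holds; and Condition 2: there do not exist SOS polynomials s₀, s₁,…,s_L with 1 + s₀ + Σ_{i=1}^L sᵢ·bᵢ = 0 identically. -/

import Mathlib

/-- A polynomial is a sum of squares. -/
def IsSOS {n : ℕ} (s : MvPolynomial (Fin n) ℝ) : Prop :=
  ∃ (k : ℕ) (p : Fin k → MvPolynomial (Fin n) ℝ), s = ∑ i, (p i) ^ 2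

/-- The Lie derivative `L_f b = ∑ i (∂b/∂xᵢ) fᵢ`. -/
noncomputable def LieF {n : ℕ} (f : Fin n → MvPolynomial (Fin n) ℝ)
    (b : MvPolynomial (Fin n) ℝ) : MvPolynomial (Fin n) ℝ :=
  ∑ i, MvPolynomial.pderiv i b * f i

/-- The `j`-th component of the Lie derivative `(L_g b)_j = ∑ i (∂b/∂xᵢ) g_{ij}`. -/
noncomputable def LieG {n m : ℕ} (g : Fin n → Fin m → MvPolynomial (Fin n) ℝ)
    (b : MvPolynomial (Fin n) ℝ) (j : Fin m) : MvPolynomial (Fin n) ℝ :=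
  ∑ i, MvPolynomial.pderiv i b * g i j

/-- Membership in the quadratic module generated by `b₁,…,b_L`:
`q = s₀ + ∑ i sᵢ bᵢ` with all `sᵢ` SOS. -/
def InQuadraticModule {n L : ℕ} (b : Fin L → MvPolynomial (Fin n) ℝ)
    (q : MvPolynomial (Fin n) ℝ) : Prop :=
  ∃ (s₀ : MvPolynomial (Fin n) ℝ) (s : Fin L → MvPolynomial (Fin n) ℝ),
    IsSOS s₀ ∧ (∀ i, IsSOS (s i)) ∧ q = s₀ + ∑ i, s i * b i


section ArchPart
open MvPolynomial

lemma isSOS_iff {n : ℕ} (s : MvPolynomial (Fin n) ℝ) : IsSOS s ↔ IsSumSq s := by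
  constructor
  · rintro ⟨k, p, rfl⟩
    exact IsSumSq.sum (fun i _ => by rw [pow_two]; exact IsSumSq.mul_self _)
  · intro h
    induction h with
    | zero => exact ⟨0, fun _ => 0, by simp⟩
    | sq_add a h ih =>
      obtain ⟨k, p, rfl⟩ := ih
      exact ⟨k + 1, Fin.cons a p, by simp [Fin.sum_univ_succ, pow_two]⟩

/-- quadratic modules -/
structure IsQM {A : Type} [CommRing A] (M : Set A) : Prop where
  add : ∀ {a b}, a ∈ M → b ∈ M → a + b ∈ M
  sq : ∀ (c : A) {a}, a ∈ M → c ^ 2 * a ∈ M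
  one : (1 : A) ∈ M
  neg_one : (-1 : A) ∉ M

lemma IsQM.zero {A : Type} [CommRing A] {M : Set A} (h : IsQM M) : (0 : A) ∈ M := by
  simpa using h.sq 0 h.one

lemma IsQM.sumsq {A : Type} [CommRing A] {M : Set A} (h : IsQM M) {s a : A} (hs : IsSumSq s)
    (ha : a ∈ M) : s * a ∈ M := by
  induction hs with
  | zero => simpa using h.zero
  | sq_add c hc ih => rw [add_mul, ← pow_two]; exact h.add (h.sq c ha) ih

lemma exists_max_QM {A : Type} [CommRing A] {M : Set A} (h : IsQM M) :
    ∃ M', M ⊆ M' ∧ Maximal IsQM M' := by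
  refine zorn_subset_nonempty {M : Set A | IsQM M} ?_ M h
  intro c hc hch hne
  refine ⟨⋃₀ c, ?_, fun s hs => Set.subset_sUnion_of_mem hs⟩
  obtain ⟨M0, hM0⟩ := hne
  refine ⟨?_, ?_, ⟨M0, hM0, (hc hM0).one⟩, ?_⟩
  · rintro a b ⟨s, hs, has⟩ ⟨t, ht, hbt⟩
    rcases hch.total hs ht with hst | hst
    · exact ⟨t, ht, (hc ht).add (hst has) hbt⟩
    · exact ⟨s, hs, (hc hs).add has (hst hbt)⟩
  · rintro x a ⟨s, hs, has⟩
    exact ⟨s, hs, (hc hs).sq x has⟩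
  · rintro ⟨s, hs, has⟩
    exact (hc hs).neg_one has

lemma IsQM.ideal {A : Type} [CommRing A] [Algebra ℝ A] {M : Set A} (h : IsQM M) {a : A}
    (ha : a ∈ M) (hna : -a ∈ M) (f : A) : f * a ∈ M := by
  have h2 : algebraMap ℝ A (1/2) + algebraMap ℝ A (1/2) = 1 := by
    rw [← map_add]; norm_num
  have := h.add (h.sq (algebraMap ℝ A (1/2) * (f + 1)) ha) (h.sq (algebraMap ℝ A (1/2) * (f - 1)) hna)
  convert this using 1
  linear_combination (-f * a) * (algebraMap ℝ A (1/2) + algebraMap ℝ A (1/2) + 1) * h2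

lemma max_QM_total {A : Type} [CommRing A] [Algebra ℝ A] {M : Set A} (h : Maximal IsQM M) (f : A) :
    f ∈ M ∨ -f ∈ M := by
  have key : ∀ f : A, f ∉ M → ∃ p ∈ M, ∃ s, IsSumSq s ∧ -1 = p + s * f := by
    intro f hf
    by_contra hcon
    push Not at hcon
    have hQ : IsQM {x : A | ∃ p ∈ M, ∃ s, IsSumSq s ∧ x = p + s * f} := by
      refine ⟨?_, ?_, ⟨1, h.prop.one, 0, IsSumSq.zero, by simp⟩, ?_⟩
      · rintro a b ⟨p, hp, s, hs, rfl⟩ ⟨p', hp', s', hs', rfl⟩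
        exact ⟨p + p', h.prop.add hp hp', s + s', hs.add hs', by ring⟩
      · rintro c a ⟨p, hp, s, hs, rfl⟩
        exact ⟨c ^ 2 * p, h.prop.sq c hp, c ^ 2 * s,
          IsSumSq.mul (by rw [pow_two]; exact IsSumSq.mul_self _) hs, by ring⟩
      · rintro ⟨p, hp, s, hs, hh⟩
        exact hcon p hp s hs hh
    have hle : M ⊆ {x : A | ∃ p ∈ M, ∃ s, IsSumSq s ∧ x = p + s * f} :=
      fun x hx => ⟨x, hx, 0, IsSumSq.zero, by simp⟩
    refine hf (h.2 hQ hle ⟨0, h.prop.zero, 1, ?_, by simp⟩)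
    simp
  by_contra hcon
  push Not at hcon
  obtain ⟨p, hp, s, hs, e⟩ := key f hcon.1
  obtain ⟨p', hp', s', hs', e'⟩ := key (-f) hcon.2
  have hM := h.prop
  have e2 : s' * (1 + p) + s * (1 + p') = 0 := by linear_combination -s' * e - s * e'
  have hsM : s ∈ M := by simpa using hM.sumsq hs hM.one
  have hsM' : -s ∈ M := by
    have : -s = s' * (1 + p) + s * p' := by linear_combination -e2
    rw [this]
    exact hM.add (hM.sumsq hs' (hM.add hM.one hp)) (hM.sumsq hs hp')
  apply hM.neg_one
  rw [e]
  refine hM.add hp ?_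
  rw [mul_comm]
  exact hM.ideal hsM hsM' f

theorem arch_point {n : ℕ} (M : Set (MvPolynomial (Fin n) ℝ)) (hM : IsQM M) (N : ℕ)
    (hN : (N : MvPolynomial (Fin n) ℝ) - ∑ i, (X i) ^ 2 ∈ M) :
    ∃ x : Fin n → ℝ, ∀ p ∈ M, 0 ≤ eval x p := by
  obtain ⟨M', hMM, hmax⟩ := exists_max_QM hM
  have hQ := hmax.prop
  have tot := max_QM_total hmax
  have hC : ∀ r : ℝ, 0 ≤ r → ∀ p ∈ M', C r * p ∈ M' := by
    intro r hr p hp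
    have := hQ.sq (C (Real.sqrt r)) hp
    rwa [← C_pow, Real.sq_sqrt hr] at this
  have hC1 : ∀ r : ℝ, 0 ≤ r → C r ∈ M' := fun r hr => by simpa using hC r hr 1 hQ.one
  have hCneg : ∀ r : ℝ, r < 0 → C r ∉ M' := by
    intro r hr h
    apply hQ.neg_one
    have := hC (-r)⁻¹ (by rw [inv_nonneg]; linarith) _ h
    rw [← C_mul] at this
    have e : (-r)⁻¹ * r = -1 := by rw [inv_neg, neg_mul, inv_mul_cancel₀ hr.ne]
    rw [e] at this
    simpa using this
  have sqM : ∀ p, p ^ 2 ∈ M' := fun p => by simpa using hQ.sq p hQ.one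
  -- bounded elements
  let B : ℝ → MvPolynomial (Fin n) ℝ → Prop := fun r p => C r - p ∈ M' ∧ C r + p ∈ M'
  have Bmono : ∀ r s p, r ≤ s → B r p → B s p := by
    intro r s p hrs h
    have h1 := hC1 (s - r) (by linarith)
    refine ⟨?_, ?_⟩
    · have := hQ.add h1 h.1
      convert this using 1; simp <;> ring
    · have := hQ.add h1 h.2
      convert this using 1; simp <;> ring
  have Badd : ∀ r s p q, B r p → B s q → B (r + s) (p + q) := by
    intro r s p q h h'
    refine ⟨?_, ?_⟩
    · convert hQ.add h.1 h'.1 using 1; simp <;> ring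
    · convert hQ.add h.2 h'.2 using 1; simp <;> ring
  have Bneg : ∀ r p, B r p → B r (-p) := by
    intro r p h
    exact ⟨by simpa using h.2, by simpa [sub_eq_add_neg] using h.1⟩
  have Bsmul : ∀ c r p, 0 ≤ c → B r p → B (c * r) (C c * p) := by
    intro c r p hc h
    refine ⟨?_, ?_⟩
    · convert hC c hc _ h.1 using 1; simp <;> ring
    · convert hC c hc _ h.2 using 1; simp <;> ring
  have Bsq : ∀ r p, 0 < r → B r p → C (r ^ 2) - p ^ 2 ∈ M' := by
    intro r p hr h
    have := hC (1 / (2 * r)) (by positivity) _ (hQ.add (hQ.sq (C r + p) h.1) (hQ.sq (C r - p) h.2))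
    convert this using 1
    have e : C (1 / (2 * r)) * (2 * C r) = (1 : MvPolynomial (Fin n) ℝ) := by
      have : (2 : MvPolynomial (Fin n) ℝ) = C 2 := (map_ofNat C 2).symm
      rw [this, ← C_mul, ← C_mul]
      have : 1 / (2 * r) * (2 * r) = 1 := by field_simp
      rw [this, C_1]
    rw [C_pow]
    linear_combination (-(C r ^ 2 - p ^ 2)) * e
  have Bofsq : ∀ r p, 0 < r → C (r ^ 2) - p ^ 2 ∈ M' → B r p := by
    intro r p hr h
    have e : C (1 / (2 * r)) * (2 * C r) = (1 : MvPolynomial (Fin n) ℝ) := by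
      have : (2 : MvPolynomial (Fin n) ℝ) = C 2 := (map_ofNat C 2).symm
      rw [this, ← C_mul, ← C_mul]
      have : 1 / (2 * r) * (2 * r) = 1 := by field_simp
      rw [this, C_1]
    rw [C_pow] at h
    refine ⟨?_, ?_⟩
    · convert hC (1 / (2 * r)) (by positivity) _ (hQ.add h (sqM (C r - p))) using 1
      linear_combination (-(C r - p)) * e
    · convert hC (1 / (2 * r)) (by positivity) _ (hQ.add h (sqM (C r + p))) using 1
      linear_combination (-(C r + p)) * e
  -- product bound
  have Bmul : ∀ d c p q, 0 < d → 0 < c → B (d * d) p → B c q →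
      B (d ^ 2 * (1 + c) ^ 2 * (1/4)) (p * q) := by
    intro d c p q hd hc hp hq
    have e : C (1 / d) * C d = (1 : MvPolynomial (Fin n) ℝ) := by
      rw [← C_mul]
      have : 1 / d * d = 1 := by field_simp
      rw [this, C_1]
    have e4 : C (1 / 4) * 4 = (1 : MvPolynomial (Fin n) ℝ) := by
      have : (4 : MvPolynomial (Fin n) ℝ) = C 4 := (map_ofNat C 4).symm
      rw [this, ← C_mul]; norm_num
    have h1 : B d (C (1 / d) * p) := by
      have := Bsmul (1 / d) _ _ (by positivity) hp
      have e' : 1 / d * (d * d) = d := by field_simp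
      rwa [e'] at this
    have h2 := Bsmul d _ _ hd.le hq
    have h3 := Bsq _ _ (by positivity) (Badd _ _ _ _ h1 h2)
    have h4 := Bsq _ _ (by positivity) (Badd _ _ _ _ h1 (Bneg _ _ h2))
    have h5 := sqM (C (1 / d) * p + C d * q)
    have h6 := sqM (C (1 / d) * p + - (C d * q))
    have e5 : (d + d * c) ^ 2 = d ^ 2 * (1 + c) ^ 2 := by ring
    rw [e5] at h3 h4
    refine ⟨?_, ?_⟩
    · convert hC (1 / 4) (by norm_num) _ (hQ.add h3 h6) using 1
      rw [C_mul (a := d ^ 2 * (1 + c) ^ 2)]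
      linear_combination (4 * C (1/4) * p * q) * e + p * q * e4
    · convert hC (1 / 4) (by norm_num) _ (hQ.add h4 h5) using 1
      rw [C_mul (a := d ^ 2 * (1 + c) ^ 2)]
      linear_combination (-4 * C (1/4) * p * q) * e - p * q * e4
  have BX : ∀ i, B (N + 1) (X i) := by
    intro i
    apply Bofsq _ _ (by positivity)
    have h1 : (N : MvPolynomial (Fin n) ℝ) - (X i) ^ 2 ∈ M' := by
      have h2 : ∑ j ∈ Finset.univ.erase i, (X j : MvPolynomial (Fin n) ℝ) ^ 2 ∈ M' := by
        refine Finset.sum_induction _ (· ∈ M') (fun a b ha hb => hQ.add ha hb) hQ.zero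
          (fun j _ => sqM _)
      convert hQ.add (hMM hN) h2 using 1
      rw [← Finset.add_sum_erase _ _ (Finset.mem_univ i)]; ring
    have h3 := hQ.add h1 (hC1 ((N + 1) ^ 2 - N) (by nlinarith [Nat.cast_nonneg (α := ℝ) N]))
    convert h3 using 1
    simp <;> ring
  -- the point
  have hpt : ∀ i, ∃ x : ℝ, ∀ ε > 0, B ε (X i - C x) := by
    intro i
    let S : Set ℝ := {r | X i - C r ∈ M'}
    have hne : S.Nonempty := ⟨-(N + 1), by
      have := (BX i).2
      change X i - C _ ∈ M'
      convert this using 1; simp; ring⟩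
    have hbd : BddAbove S := by
      refine ⟨N + 1, fun r hr => ?_⟩
      by_contra hcon
      push Not at hcon
      have := hQ.add hr (BX i).1
      refine hCneg (N + 1 - r) (by linarith) ?_
      convert this using 1; simp <;> ring
    refine ⟨sSup S, fun ε hε => ⟨?_, ?_⟩⟩
    · have h1 : sSup S + ε ∉ S := fun h => by have := le_csSup hbd h; linarith
      rcases tot (X i - C (sSup S + ε)) with h | h
      · exact absurd h h1
      · convert h using 1; simp <;> ring
    · obtain ⟨r, hr, hlt⟩ := exists_lt_of_lt_csSup hne (show sSup S - ε < sSup S by linarith)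
      have := hQ.add hr (hC1 (r - (sSup S - ε)) (by linarith))
      convert this using 1; simp <;> ring
  choose x hx using hpt
  have Bconst : ∀ r, B |r| (C r) := by
    intro r
    refine ⟨?_, ?_⟩
    · rw [← C_sub]; exact hC1 _ (by linarith [le_abs_self r])
    · rw [← C_add]; exact hC1 _ (by linarith [neg_abs_le r])
  have Jmul : ∀ p q c, (∀ ε > 0, B ε p) → 0 < c → B c q → ∀ ε > 0, B ε (p * q) := by
    intro p q c hp hc hq ε hε
    set d := Real.sqrt (ε / (1 + c) ^ 2) with hd
    have hd0 : 0 < d := Real.sqrt_pos.2 (by positivity)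
    have hd2 : d ^ 2 = ε / (1 + c) ^ 2 := Real.sq_sqrt (by positivity)
    refine Bmono _ _ _ ?_ (Bmul d c p q hd0 hc (hp _ (by positivity)) hq)
    rw [hd2]
    field_simp
    linarith
  have main : ∀ p : MvPolynomial (Fin n) ℝ, ∀ ε > 0, B ε (p - C (eval x p)) := by
    intro p
    induction p using MvPolynomial.induction_on with
    | C a =>
      intro ε hε
      simpa [B] using hC1 ε hε.le
    | add p q hp hq =>
      intro ε hε
      convert Badd _ _ _ _ (hp (ε / 2) (by linarith)) (hq (ε / 2) (by linarith)) using 1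
      · ring
      · simp <;> ring
    | mul_X p i hp =>
      intro ε hε
      have h1 := Jmul _ _ _ hp (by positivity) (BX i) (ε / 2) (by linarith)
      have h2 := Jmul _ _ _ (hx i) (by positivity : (0:ℝ) < |eval x p| + 1)
        (Bmono _ _ _ (by linarith) (Bconst (eval x p))) (ε / 2) (by linarith)
      convert Badd _ _ _ _ h1 h2 using 1
      · ring
      · simp <;> ring
  refine ⟨x, fun p hp => ?_⟩
  by_contra hcon
  push Not at hcon
  have h1 := (main p (-(eval x p) / 2) (by linarith)).1
  have h2 := hQ.add h1 (hMM hp)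
  refine hCneg ((eval x p) / 2) (by linarith) ?_
  convert h2 using 1
  have : C (eval x p) = C (eval x p / 2) + (C (eval x p / 2) : MvPolynomial (Fin n) ℝ) := by
    rw [← C_add]; congr 1; ring
  have h3 : (C (-(eval x p) / 2) : MvPolynomial (Fin n) ℝ) = - C (eval x p / 2) := by
    rw [← C_neg]; congr 1; ring
  rw [h3, this]
  ring

end ArchPart

section RealClosure
open Polynomial

/-- preorders avoiding all `-F^(2a)` -/
structure IsPO {A : Type} [CommRing A] (F : A) (T : Set A) : Prop where
  add : ∀ {a b}, a ∈ T → b ∈ T → a + b ∈ T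
  mul : ∀ {a b}, a ∈ T → b ∈ T → a * b ∈ T
  sq : ∀ (c : A), c ^ 2 ∈ T
  neg_pow : ∀ k : ℕ, -F ^ (2 * k) ∉ T

lemma exists_max_PO {A : Type} [CommRing A] {F : A} {T : Set A} (h : IsPO F T) :
    ∃ P, T ⊆ P ∧ Maximal (IsPO F) P := by
  refine zorn_subset_nonempty {M : Set A | IsPO F M} ?_ T h
  intro c hc hch hne
  refine ⟨⋃₀ c, ?_, fun s hs => Set.subset_sUnion_of_mem hs⟩
  obtain ⟨M0, hM0⟩ := hne
  refine ⟨?_, ?_, fun x => ⟨M0, hM0, (hc hM0).sq x⟩, ?_⟩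
  · rintro a b ⟨s, hs, has⟩ ⟨t, ht, hbt⟩
    rcases hch.total hs ht with hst | hst
    · exact ⟨t, ht, (hc ht).add (hst has) hbt⟩
    · exact ⟨s, hs, (hc hs).add has (hst hbt)⟩
  · rintro a b ⟨s, hs, has⟩ ⟨t, ht, hbt⟩
    rcases hch.total hs ht with hst | hst
    · exact ⟨t, ht, (hc ht).mul (hst has) hbt⟩
    · exact ⟨s, hs, (hc hs).mul has (hst hbt)⟩
  · rintro k ⟨s, hs, has⟩
    exact (hc hs).neg_pow k has

lemma max_PO_key {A : Type} [CommRing A] {F : A} {P : Set A} (h : Maximal (IsPO F) P) (f : A)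
    (hf : f ∉ P) : ∃ k : ℕ, ∃ p ∈ P, ∃ q ∈ P, -F ^ (2 * k) = p + f * q := by
  have hP := h.prop
  have h0 : (0 : A) ∈ P := by simpa using hP.sq 0
  have h1 : (1 : A) ∈ P := by simpa using hP.sq 1
  by_contra hcon
  push Not at hcon
  have hQ : IsPO F {x : A | ∃ p ∈ P, ∃ q ∈ P, x = p + f * q} := by
    refine ⟨?_, ?_, fun c => ⟨c ^ 2, hP.sq c, 0, h0, by simp⟩, ?_⟩
    · rintro a b ⟨p, hp, q, hq, rfl⟩ ⟨p', hp', q', hq', rfl⟩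
      exact ⟨p + p', hP.add hp hp', q + q', hP.add hq hq', by ring⟩
    · rintro a b ⟨p, hp, q, hq, rfl⟩ ⟨p', hp', q', hq', rfl⟩
      exact ⟨p * p' + f ^ 2 * (q * q'), hP.add (hP.mul hp hp') (hP.mul (hP.sq f) (hP.mul hq hq')),
        p * q' + q * p', hP.add (hP.mul hp hq') (hP.mul hq hp'), by ring⟩
    · rintro k ⟨p, hp, q, hq, e⟩
      exact hcon k p hp q hq e
  exact hf (h.2 hQ (fun x hx => ⟨x, hx, 0, h0, by simp⟩) ⟨0, h0, 1, h1, by simp⟩)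

lemma max_PO_total {A : Type} [CommRing A] {F : A} {P : Set A} (h : Maximal (IsPO F) P) (f : A) :
    f ∈ P ∨ -f ∈ P := by
  by_contra hcon
  push Not at hcon
  have hP := h.prop
  obtain ⟨k, p, hp, q, hq, e⟩ := max_PO_key h f hcon.1
  obtain ⟨k', p', hp', q', hq', e'⟩ := max_PO_key h (-f) hcon.2
  apply hP.neg_pow (k + k')
  have hk : F ^ (2 * k) ∈ P := by rw [mul_comm, pow_mul]; exact hP.sq _
  have hk' : F ^ (2 * k') ∈ P := by rw [mul_comm, pow_mul]; exact hP.sq _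
  have : -F ^ (2 * (k + k')) = f ^ 2 * (q * q') + (F ^ (2 * k) * p' + p * F ^ (2 * k') + p * p') := by
    rw [mul_add, pow_add]
    linear_combination  (p' + F ^ (2 * k')) * e - (f * q) * e'
  rw [this]
  exact hP.add (hP.mul (hP.sq f) (hP.mul hq hq'))
    (hP.add (hP.add (hP.mul hk hp') (hP.mul hp hk')) (hP.mul hp hp'))

lemma max_PO_ideal {A : Type} [CommRing A] {F : A} {P : Set A} (h : Maximal (IsPO F) P) {a : A}
    (ha : a ∈ P) (hna : -a ∈ P) (f : A) : f * a ∈ P := by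
  rcases max_PO_total h f with hf | hf
  · exact h.prop.mul hf ha
  · simpa using h.prop.mul hf hna

lemma max_PO_prime {A : Type} [CommRing A] {F : A} {P : Set A} (h : Maximal (IsPO F) P) {f g : A}
    (hfg : f * g ∈ P) (hnfg : -(f * g) ∈ P) : (f ∈ P ∧ -f ∈ P) ∨ (g ∈ P ∧ -g ∈ P) := by
  have hP := h.prop
  have key : ∀ f g : A, f * g ∈ P → -(f * g) ∈ P → f ∉ P → g ∉ P → False := by
    intro f g hfg hnfg hf hg
    obtain ⟨k, p, hp, q, hq, e⟩ := max_PO_key h f hf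
    obtain ⟨k', p', hp', q', hq', e'⟩ := max_PO_key h g hg
    apply hP.neg_pow (k + k')
    have hk : F ^ (2 * k) ∈ P := by rw [mul_comm, pow_mul]; exact hP.sq _
    have hk' : F ^ (2 * k') ∈ P := by rw [mul_comm, pow_mul]; exact hP.sq _
    have : -F ^ (2 * (k + k')) =
        (q * q') * -(f * g) + (F ^ (2 * k) * p' + p * F ^ (2 * k') + p * p') := by
      rw [mul_add, pow_add]
      linear_combination  (p' + F ^ (2 * k')) * e - (f * q) * e'
    rw [this]
    exact hP.add (hP.mul (hP.mul hq hq') hnfg)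
      (hP.add (hP.add (hP.mul hk hp') (hP.mul hp hk')) (hP.mul hp hp'))
  by_contra hcon
  rw [not_or] at hcon
  obtain ⟨h1, h2⟩ := hcon
  rw [not_and_or] at h1 h2
  rcases h1 with h1 | h1 <;> rcases h2 with h2 | h2
  · exact key f g hfg hnfg h1 h2
  · exact key f (-g) (by simpa using hnfg) (by simpa using hfg) h1 h2
  · exact key (-f) g (by simpa using hnfg) (by simpa using hfg) h1 h2
  · exact key (-f) (-g) (by simpa using hfg) (by simpa using hnfg) h1 h2

/-- Cone of an ordered subfield. -/
structure SubCone {Ω : Type} [Field Ω] (P : Set Ω) : Prop where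
  add : ∀ {a b}, a ∈ P → b ∈ P → a + b ∈ P
  mul : ∀ {a b}, a ∈ P → b ∈ P → a * b ∈ P
  one : (1 : Ω) ∈ P
  neg_one : (-1 : Ω) ∉ P
  sub : ∀ {a b}, a ∈ P → b ∈ P → a - b ∈ P ∨ b - a ∈ P
  inv : ∀ {a}, a ∈ P → a⁻¹ ∈ P

lemma exists_max_SubCone {Ω : Type} [Field Ω] {T : Set Ω} (h : SubCone T) :
    ∃ P, T ⊆ P ∧ Maximal SubCone P := by
  refine zorn_subset_nonempty {M : Set Ω | SubCone M} ?_ T h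
  intro c hc hch hne
  refine ⟨⋃₀ c, ?_, fun s hs => Set.subset_sUnion_of_mem hs⟩
  obtain ⟨M0, hM0⟩ := hne
  refine ⟨?_, ?_, ⟨M0, hM0, (hc hM0).one⟩, ?_, ?_, ?_⟩
  · rintro a b ⟨s, hs, has⟩ ⟨t, ht, hbt⟩
    rcases hch.total hs ht with hst | hst
    · exact ⟨t, ht, (hc ht).add (hst has) hbt⟩
    · exact ⟨s, hs, (hc hs).add has (hst hbt)⟩
  · rintro a b ⟨s, hs, has⟩ ⟨t, ht, hbt⟩
    rcases hch.total hs ht with hst | hst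
    · exact ⟨t, ht, (hc ht).mul (hst has) hbt⟩
    · exact ⟨s, hs, (hc hs).mul has (hst hbt)⟩
  · rintro ⟨s, hs, has⟩
    exact (hc hs).neg_one has
  · rintro a b ⟨s, hs, has⟩ ⟨t, ht, hbt⟩
    rcases hch.total hs ht with hst | hst
    · exact ((hc ht).sub (hst has) hbt).imp (fun h => ⟨t, ht, h⟩) (fun h => ⟨t, ht, h⟩)
    · exact ((hc hs).sub has (hst hbt)).imp (fun h => ⟨s, hs, h⟩) (fun h => ⟨s, hs, h⟩)
  · rintro a ⟨s, hs, has⟩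
    exact ⟨s, hs, (hc hs).inv has⟩

namespace SubCone
variable {Ω : Type} [Field Ω] {P : Set Ω}

lemma zero (h : SubCone P) : (0 : Ω) ∈ P := by
  rcases h.sub h.one h.one with h | h <;> simpa using h

lemma anti (h : SubCone P) {a : Ω} (ha : a ∈ P) (hna : -a ∈ P) : a = 0 := by
  by_contra h0
  apply h.neg_one
  have := h.mul hna (h.inv ha)
  rwa [neg_mul, mul_inv_cancel₀ h0] at this

/-- The subfield of a cone. -/
def fld (h : SubCone P) : Subfield Ω where
  carrier := {a | a ∈ P ∨ -a ∈ P}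
  zero_mem' := Or.inl h.zero
  one_mem' := Or.inl h.one
  add_mem' := by
    rintro a b (ha | ha) (hb | hb)
    · exact Or.inl (h.add ha hb)
    · rcases h.sub ha hb with h | h
      · left; simpa using h
      · right; convert h using 1; ring
    · rcases h.sub hb ha with h | h
      · left; convert h using 1; ring
      · right; convert h using 1; ring
    · right; convert h.add ha hb using 1; ring
  mul_mem' := by
    rintro a b (ha | ha) (hb | hb)
    · exact Or.inl (h.mul ha hb)
    · right; simpa using h.mul ha hb
    · right; simpa using h.mul ha hb
    · left; simpa using h.mul ha hb
  neg_mem' := by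
    rintro a (ha | ha)
    · right; simpa using ha
    · left; exact ha
  inv_mem' := by
    rintro a (ha | ha)
    · left; exact h.inv ha
    · right; rw [← inv_neg]; exact h.inv ha

lemma mem_fld (h : SubCone P) {a : Ω} : a ∈ h.fld ↔ (a ∈ P ∨ -a ∈ P) := Iff.rfl

/-- The order. -/
@[reducible] noncomputable def linOrd (h : SubCone P) : LinearOrder h.fld where
  le a b := (b : Ω) - a ∈ P
  le_refl a := by simpa using h.zero
  le_trans a b c hab hbc := by
    have := h.add hab hbc
    change (c : Ω) - a ∈ P
    convert this using 1; ring
  le_antisymm a b hab hba := by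
    have : (b : Ω) - a = 0 := h.anti hab (by rw [neg_sub]; exact hba)
    exact Subtype.ext (sub_eq_zero.1 this).symm
  le_total a b := by
    have := (h.fld.sub_mem b.2 a.2)
    rcases this with h | h
    · exact Or.inl h
    · right; change (a : Ω) - b ∈ P; rwa [neg_sub] at h
  toDecidableLE := Classical.decRel _

lemma ordRing (h : SubCone P) : letI := h.linOrd; IsStrictOrderedRing h.fld := by
  letI := h.linOrd
  have h1 : IsOrderedAddMonoid h.fld := by
    refine { add_le_add_left := fun a b hab c => ?_ }
    change ((b + c : h.fld) : Ω) - (a + c : h.fld) ∈ P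
    have : (b : Ω) - a ∈ P := hab
    convert this using 1
    push_cast; ring
  have h2 : ZeroLEOneClass h.fld := ⟨by
    change ((1 : h.fld) : Ω) - (0 : h.fld) ∈ P
    simpa using h.one⟩
  refine IsStrictOrderedRing.of_mul_pos ?_
  intro a b ha hb
  have ha1 : (a : Ω) ∈ P := by have : (a : Ω) - (0 : h.fld) ∈ P := ha.le; simpa using this
  have hb1 : (b : Ω) ∈ P := by have : (b : Ω) - (0 : h.fld) ∈ P := hb.le; simpa using this
  refine lt_of_le_of_ne ?_ (mul_ne_zero ha.ne' hb.ne').symm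
  change ((a * b : h.fld) : Ω) - (0 : h.fld) ∈ P
  simpa using h.mul ha1 hb1

lemma nonneg_iff (h : SubCone P) (a : h.fld) : letI := h.linOrd; 0 ≤ a ↔ (a : Ω) ∈ P := by
  letI := h.linOrd
  change (a : Ω) - (0 : h.fld) ∈ P ↔ _
  simp

end SubCone

section ext
variable {R : Type} [Field R] [LinearOrder R] [IsStrictOrderedRing R]

/-- weighted sums of squares -/
inductive WSS (R : Type) [Field R] [LinearOrder R] {B : Type} [CommRing B] [Algebra R B] : B → Prop
  | zero : WSS R 0
  | sq_add (c : R) (hc : 0 ≤ c) (q s : B) (hs : WSS R s) : WSS R (algebraMap R B c * q ^ 2 + s)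

lemma WSS.add {B : Type} [CommRing B] [Algebra R B] {s t : B} (hs : WSS R s)
    (ht : WSS R t) : WSS R (s + t) := by
  induction hs with
  | zero => simpa
  | sq_add c hc q s hs ih => rw [add_assoc]; exact .sq_add c hc q _ ih

lemma WSS.smul {B : Type} [CommRing B] [Algebra R B] {s : B} (hs : WSS R s) (c : R)
    (hc : 0 ≤ c) (q : B) : WSS R (algebraMap R B c * q ^ 2 * s) := by
  induction hs with
  | zero => simpa using WSS.zero
  | sq_add c' hc' q' s hs ih =>
    have := WSS.sq_add (c * c') (mul_nonneg hc hc') (q * q') _ ih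
    convert this using 1
    rw [map_mul]; ring

lemma WSS.mul {B : Type} [CommRing B] [Algebra R B] {s t : B} (hs : WSS R s)
    (ht : WSS R t) : WSS R (s * t) := by
  induction hs with
  | zero => simpa using WSS.zero
  | sq_add c hc q s hs ih => rw [add_mul]; exact (ht.smul c hc q).add ih

lemma WSS.eval_nonneg {s : R[X]} (hs : WSS R s) (a : R) : 0 ≤ s.eval a := by
  induction hs with
  | zero => simp
  | sq_add c hc q s hs ih =>
    simp only [eval_add, eval_mul, eval_pow, algebraMap_eq, eval_C]
    positivity

lemma WSS.reduce {s : R[X]} (hs : WSS R s) (p : R[X]) (hp : 0 < p.natDegree) :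
    ∃ s', WSS R s' ∧ p ∣ s - s' ∧ s'.natDegree ≤ 2 * (p.natDegree - 1) := by
  induction hs with
  | zero => exact ⟨0, .zero, by simp, by simp⟩
  | sq_add c hc q s hs ih =>
    obtain ⟨s', hs', hd, hdeg⟩ := ih
    refine ⟨algebraMap R R[X] c * (q % p) ^ 2 + s', .sq_add c hc _ _ hs', ?_, ?_⟩
    · have h1 : p ∣ q - q % p := by
        have := EuclideanDomain.div_add_mod q p
        exact ⟨q / p, by linear_combination -this⟩
      have : algebraMap R R[X] c * q ^ 2 + s - (algebraMap R R[X] c * (q % p) ^ 2 + s') =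
        (q - q % p) * (algebraMap R R[X] c * (q + q % p)) + (s - s') := by ring
      rw [this]
      exact dvd_add (h1.mul_right _) hd
    · refine natDegree_add_le_of_degree_le ?_ hdeg
      refine (natDegree_C_mul_le c _).trans ?_
      refine natDegree_pow_le.trans ?_
      have := natDegree_mod_lt q hp.ne'
      gcongr
      omega

lemma WSS.not_dvd (a b : R) : ∀ (n : ℕ) (p : R[X]), p.natDegree ≤ n → p.eval a * p.eval b < 0 →
    ∀ s : R[X], WSS R s → ¬ p ∣ 1 + s := by
  intro n
  induction n with
  | zero =>
    intro p hp hab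
    rw [eq_C_of_natDegree_le_zero hp] at hab
    simp only [eval_C] at hab
    exact absurd hab (not_lt.2 (mul_self_nonneg _))
  | succ n ih =>
    intro p hp hab s hs hdvd
    rcases Nat.eq_zero_or_pos p.natDegree with h0 | h0
    · rw [eq_C_of_natDegree_le_zero h0.le] at hab
      simp only [eval_C] at hab
      exact absurd hab (not_lt.2 (mul_self_nonneg _))
    obtain ⟨s', hs', hd, hdeg⟩ := hs.reduce p h0
    have hdvd' : p ∣ 1 + s' := by
      have := dvd_sub hdvd hd
      convert this using 1; ring
    obtain ⟨h, hh⟩ := hdvd'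
    have ea := congrArg (eval a) hh
    have eb := congrArg (eval b) hh
    simp only [eval_add, eval_one, eval_mul] at ea eb
    have pa : 0 < p.eval a * h.eval a := by rw [← ea]; linarith [hs'.eval_nonneg a]
    have pb : 0 < p.eval b * h.eval b := by rw [← eb]; linarith [hs'.eval_nonneg b]
    have hhab : h.eval a * h.eval b < 0 := by
      have := mul_pos pa pb
      by_contra hcon
      push Not at hcon
      nlinarith [mul_nonneg (neg_nonneg.2 hab.le) hcon]
    have hp0 : p ≠ 0 := by rintro rfl; simp at h0
    have hh0 : h ≠ 0 := by rintro rfl; simp at hhab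
    refine ih h ?_ hhab s' hs' ⟨p, by rw [hh, mul_comm]⟩
    have h1 : (p * h).natDegree = p.natDegree + h.natDegree := natDegree_mul hp0 hh0
    have h2 : (1 + s').natDegree ≤ 2 * (p.natDegree - 1) :=
      natDegree_add_le_of_degree_le (by simp) hdeg
    rw [hh, h1] at h2
    omega

lemma exists_irred_factor (a b : R) (p : R[X]) (hab : p.eval a * p.eval b < 0) :
    ∃ q, Irreducible q ∧ q ∣ p ∧ q.eval a * q.eval b < 0 := by
  have hp0 : p ≠ 0 := by rintro rfl; simp at hab
  induction p using WfDvdMonoid.induction_on_irreducible with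
  | zero => exact absurd rfl hp0
  | unit u hu =>
    exfalso
    rw [eq_C_of_natDegree_le_zero (natDegree_eq_zero_of_isUnit hu).le] at hab
    simp only [eval_C] at hab
    exact absurd hab (not_lt.2 (mul_self_nonneg _))
  | mul p i hp hi ih =>
    by_cases h : i.eval a * i.eval b < 0
    · exact ⟨i, hi, dvd_mul_right _ _, h⟩
    · have : p.eval a * p.eval b < 0 := by
        by_contra hcon
        push Not at h hcon
        simp only [eval_mul] at hab
        nlinarith [mul_nonneg h hcon]
      obtain ⟨q, hq, hd, hlt⟩ := ih this hp
      exact ⟨q, hq, hd.mul_left _, hlt⟩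

end ext
end RealClosure

section RealClosure2
open Polynomial

/-- polynomial IVT -/
def PolyIVT (R : Type) [Field R] [LinearOrder R] : Prop :=
  ∀ (p : R[X]) (a b : R), a < b → p.eval a * p.eval b < 0 → ∃ c, a < c ∧ c < b ∧ p.eval c = 0

lemma WSS.lift_adjoin {R : Type} [Field R] [LinearOrder R] {q : R[X]} {z : AdjoinRoot q}
    (hz : WSS R z) : ∃ s : R[X], WSS R s ∧ AdjoinRoot.mk q s = z := by
  induction hz with
  | zero => exact ⟨0, .zero, by simp⟩
  | sq_add c hc t s hs ih =>
    obtain ⟨s', hs', rfl⟩ := ih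
    obtain ⟨t', rfl⟩ := AdjoinRoot.mk_surjective t
    exact ⟨_, .sq_add c hc t' s' hs', by simp [AdjoinRoot.algebraMap_eq]⟩

lemma max_ivt {Ω : Type} [Field Ω] [IsAlgClosed Ω] {P : Set Ω} (h : Maximal SubCone P) :
    letI := h.prop.linOrd
    PolyIVT h.prop.fld := by
  let _ := h.prop.linOrd
  have _ := h.prop.ordRing
  intro p a b hab hp
  obtain ⟨q, hq, hqp, hqab⟩ := exists_irred_factor a b p hp
  have _ : Fact (Irreducible q) := ⟨hq⟩
  obtain ⟨α, hα⟩ := IsAlgClosed.exists_eval₂_eq_zero h.prop.fld.subtype q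
    (degree_pos_of_irreducible hq).ne'
  have hPO : IsPO (1 : AdjoinRoot q) {z | WSS h.prop.fld z} := by
    refine ⟨fun ha hb => ha.add hb, fun ha hb => ha.mul hb, fun c => ?_, ?_⟩
    · have := WSS.sq_add (R := h.prop.fld) 1 zero_le_one c 0 .zero
      simpa using this
    · intro k hk
      rw [one_pow] at hk
      obtain ⟨s, hs, e⟩ := WSS.lift_adjoin hk
      refine WSS.not_dvd a b _ q le_rfl hqab s hs ?_
      rw [← AdjoinRoot.mk_eq_zero, map_add, e]; simp
  obtain ⟨P', hTP, hP'⟩ := exists_max_PO hPO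
  let σ : AdjoinRoot q →+* Ω := AdjoinRoot.lift h.prop.fld.subtype α hα
  have hσ : Function.Injective σ := σ.injective
  have hcone : SubCone (σ '' P') := by
    refine ⟨?_, ?_, ⟨1, by simpa using hP'.prop.sq 1, map_one σ⟩, ?_, ?_, ?_⟩
    · rintro _ _ ⟨x, hx, rfl⟩ ⟨y, hy, rfl⟩
      exact ⟨_, hP'.prop.add hx hy, map_add σ _ _⟩
    · rintro _ _ ⟨x, hx, rfl⟩ ⟨y, hy, rfl⟩
      exact ⟨_, hP'.prop.mul hx hy, map_mul σ _ _⟩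
    · rintro ⟨x, hx, e⟩
      have : x = -1 := hσ (by simpa using e)
      apply hP'.prop.neg_pow 0
      simpa [← this] using hx
    · rintro _ _ ⟨x, hx, rfl⟩ ⟨y, hy, rfl⟩
      rcases max_PO_total hP' (x - y) with hh | hh
      · exact Or.inl ⟨_, hh, map_sub σ _ _⟩
      · exact Or.inr ⟨_, hh, by simp⟩
    · rintro _ ⟨x, hx, rfl⟩
      refine ⟨x⁻¹, ?_, map_inv₀ σ _⟩
      by_cases h0 : x = 0
      · rw [h0, inv_zero, ← h0]; exact hx
      · have := hP'.prop.mul hx (hP'.prop.sq x⁻¹)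
        convert this using 1
        field_simp
  have hle : P ⊆ σ '' P' := by
    intro c hc
    let c' : h.prop.fld := ⟨c, Or.inl hc⟩
    have hc' : 0 ≤ c' := (h.prop.nonneg_iff c').2 hc
    refine ⟨algebraMap _ _ c', hTP ?_, ?_⟩
    · have := WSS.sq_add c' hc' (1 : AdjoinRoot q) 0 .zero
      simpa using this
    · simp [σ, AdjoinRoot.algebraMap_eq, c']
  have hge := h.2 hcone hle
  have hαmem : α ∈ h.prop.fld := by
    have e : σ (AdjoinRoot.root q) = α := AdjoinRoot.lift_root hα
    rw [SubCone.mem_fld]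
    rcases max_PO_total hP' (AdjoinRoot.root q) with hh | hh
    · left; exact hge ⟨_, hh, e⟩
    · right; exact hge ⟨_, hh, by rw [map_neg, e]⟩
  let r : h.prop.fld := ⟨α, hαmem⟩
  have hr : q.eval r = 0 := by
    apply h.prop.fld.subtype.injective
    rw [map_zero, ← hα]
    exact (eval₂_at_apply h.prop.fld.subtype r).symm
  obtain ⟨u, hu⟩ := dvd_iff_isRoot.2 hr
  have hun : IsUnit u := by
    rcases hq.isUnit_or_isUnit hu with h1 | h1
    · exact absurd h1 (not_isUnit_X_sub_C r)
    · exact h1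
  rw [eq_C_of_natDegree_le_zero (natDegree_eq_zero_of_isUnit hun).le] at hu
  set v := u.coeff 0
  rw [hu] at hqab
  simp only [eval_mul, eval_sub, eval_X, eval_C] at hqab
  refine ⟨r, ?_, ?_, ?_⟩
  · by_contra hcon
    push Not at hcon
    have : 0 ≤ (a - r) * (b - r) := mul_nonneg (by linarith) (by linarith)
    nlinarith [mul_nonneg this (mul_self_nonneg v)]
  · by_contra hcon
    push Not at hcon
    have : 0 ≤ (r - a) * (r - b) := mul_nonneg (by linarith) (by linarith)
    nlinarith [mul_nonneg this (mul_self_nonneg v)]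
  · exact eval_eq_zero_of_dvd_of_eval_eq_zero hqp hr

theorem exists_rcf {A : Type} [CommRing A] (F : A) (T : Set A) (hT : IsPO F T) :
    ∃ (R : Type) (_ : Field R) (_ : LinearOrder R) (_ : IsStrictOrderedRing R),
      PolyIVT R ∧ ∃ φ : A →+* R, (∀ a ∈ T, 0 ≤ φ a) ∧ φ F ≠ 0 := by
  obtain ⟨P, hTP, hP⟩ := exists_max_PO hT
  have hP0 : (0 : A) ∈ P := by simpa using hP.prop.sq 0
  let I : Ideal A :=
    { carrier := {a | a ∈ P ∧ -a ∈ P}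
      zero_mem' := ⟨hP0, by simpa using hP0⟩
      add_mem' := by
        rintro a b ⟨h1, h2⟩ ⟨h3, h4⟩
        refine ⟨hP.prop.add h1 h3, ?_⟩
        rw [neg_add]; exact hP.prop.add h2 h4
      smul_mem' := by
        rintro c a ⟨h1, h2⟩
        refine ⟨max_PO_ideal hP h1 h2 c, ?_⟩
        have := max_PO_ideal hP h2 (by simpa using h1) c
        simpa using this }
  have hI : ∀ a, a ∈ I ↔ a ∈ P ∧ -a ∈ P := fun a => Iff.rfl
  have hneg1 : (-1 : A) ∉ P := by simpa using hP.prop.neg_pow 0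
  have hprime : I.IsPrime := by
    refine ⟨?_, ?_⟩
    · rw [Ideal.ne_top_iff_one]
      intro h; exact hneg1 h.2
    · intro x y hxy
      exact max_PO_prime hP hxy.1 hxy.2
  let ψ : A →+* AlgebraicClosure (FractionRing (A ⧸ I)) :=
    ((algebraMap (FractionRing (A ⧸ I)) (AlgebraicClosure (FractionRing (A ⧸ I)))).comp
      (algebraMap (A ⧸ I) (FractionRing (A ⧸ I)))).comp (Ideal.Quotient.mk I)
  have hψ : ∀ a, ψ a = 0 ↔ a ∈ I := by
    intro a
    simp only [ψ, RingHom.comp_apply, map_eq_zero]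
    rw [← Ideal.Quotient.eq_zero_iff_mem]
    exact (IsFractionRing.injective (A ⧸ I) (FractionRing (A ⧸ I))).eq_iff' (map_zero _)
  have hcone : SubCone {z | ∃ p ∈ P, ∃ q, ψ q ≠ 0 ∧ z = ψ p / ψ q ^ 2} := by
    refine ⟨?_, ?_, ⟨1, by simpa using hP.prop.sq 1, 1, by simp, by simp⟩, ?_, ?_, ?_⟩
    · rintro _ _ ⟨p, hp, q, hq, rfl⟩ ⟨p', hp', q', hq', rfl⟩
      refine ⟨p * q' ^ 2 + p' * q ^ 2,
        hP.prop.add (hP.prop.mul hp (hP.prop.sq _)) (hP.prop.mul hp' (hP.prop.sq _)), q * q',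
        by rw [map_mul]; exact mul_ne_zero hq hq', ?_⟩
      simp only [map_add, map_mul, map_pow]
      field_simp
    · rintro _ _ ⟨p, hp, q, hq, rfl⟩ ⟨p', hp', q', hq', rfl⟩
      refine ⟨p * p', hP.prop.mul hp hp', q * q',
        by rw [map_mul]; exact mul_ne_zero hq hq', ?_⟩
      simp only [map_mul]
      field_simp
    · rintro ⟨p, hp, q, hq, e⟩
      have e1 : ψ (p + q ^ 2) = 0 := by
        rw [map_add, map_pow]
        field_simp at e
        linear_combination -e
      have e2 := ((hI _).1 ((hψ _).1 e1)).2
      have e3 : -q ^ 2 ∈ P := by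
        have := hP.prop.add hp e2
        convert this using 1; ring
      have e4 : q ^ 2 ∈ I := (hI _).2 ⟨hP.prop.sq q, e3⟩
      exact hq ((hψ q).2 (hprime.mem_of_pow_mem 2 e4))
    · rintro _ _ ⟨p, hp, q, hq, rfl⟩ ⟨p', hp', q', hq', rfl⟩
      rcases max_PO_total hP (p * q' ^ 2 - p' * q ^ 2) with hh | hh
      · left
        refine ⟨_, hh, q * q', by rw [map_mul]; exact mul_ne_zero hq hq', ?_⟩
        simp only [map_sub, map_mul, map_pow]
        field_simp
      · right
        refine ⟨_, hh, q * q', by rw [map_mul]; exact mul_ne_zero hq hq', ?_⟩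
        simp only [map_neg, map_sub, map_mul, map_pow]
        field_simp
        ring
    · rintro _ ⟨p, hp, q, hq, rfl⟩
      by_cases h0 : ψ p = 0
      · exact ⟨0, hP0, 1, by simp, by simp [h0]⟩
      · refine ⟨p * q ^ 2, hP.prop.mul hp (hP.prop.sq _), p, h0, ?_⟩
        simp only [map_mul, map_pow]
        field_simp
  obtain ⟨C, hC, hmax⟩ := exists_max_SubCone hcone
  have hψC : ∀ p ∈ P, ψ p ∈ C := fun p hp => hC ⟨p, hp, 1, by simp, by simp⟩
  have hmem : ∀ a, ψ a ∈ hmax.prop.fld := by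
    intro a
    rw [SubCone.mem_fld]
    rcases max_PO_total hP a with h | h
    · exact Or.inl (hψC _ h)
    · right; rw [← map_neg]; exact hψC _ h
  refine ⟨hmax.prop.fld, inferInstance, hmax.prop.linOrd, hmax.prop.ordRing, max_ivt hmax,
    ψ.codRestrict hmax.prop.fld hmem, ?_, ?_⟩
  · intro a ha
    exact (hmax.prop.nonneg_iff _).2 (hψC a (hTP ha))
  · intro h0
    have h1 : ψ F = 0 := congrArg Subtype.val h0
    have h2 := (hI _).1 ((hψ F).1 h1)
    apply hP.prop.neg_pow 1
    have := hP.prop.mul h2.1 h2.2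
    convert this using 1
    ring

end RealClosure2

section Thom
open Polynomial

variable {R : Type} [Field R] [LinearOrder R] [IsStrictOrderedRing R]

lemma finite_left (Z : Set R) (hZ : Z.Finite) (y : R) :
    (∃ z ∈ Z, z < y ∧ ∀ t ∈ Z, t < y → t ≤ z) ∨ (∀ t ∈ Z, ¬ t < y) := by
  by_cases h : ∃ t ∈ Z, t < y
  · left
    have hf : (Z ∩ {t | t < y}).Finite := hZ.inter_of_left _
    obtain ⟨t, ht, hty⟩ := h
    obtain ⟨z, hz, hmax⟩ := Set.exists_max_image _ id hf ⟨t, ht, hty⟩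
    exact ⟨z, hz.1, hz.2, fun t ht hty => hmax t ⟨ht, hty⟩⟩
  · right; push Not at h ⊢; exact h

lemma finite_gap (Z : Set R) (hZ : Z.Finite) (a b : R) (hab : a < b) :
    ∃ y, a < y ∧ y < b ∧ ∀ t ∈ Z, a < t → y < t := by
  have hf : (insert b (Z ∩ {t | a < t})).Finite := (hZ.inter_of_left _).insert _
  obtain ⟨z, hz, hmin⟩ := Set.exists_min_image _ id hf ⟨b, Set.mem_insert _ _⟩
  have haz : a < z := by
    rcases hz with rfl | hz
    · exact hab
    · exact hz.2
  refine ⟨(a + z) / 2, by linarith, ?_, ?_⟩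
  · have := hmin b (Set.mem_insert _ _)
    simp only [id] at this
    linarith
  · intro t ht hat
    have := hmin t (Set.mem_insert_of_mem _ ⟨ht, hat⟩)
    simp only [id] at this
    linarith

lemma roots_finite (p : R[X]) (hp : p ≠ 0) : {x | p.eval x = 0}.Finite := by
  have := p.rootSet_finite R
  refine this.subset fun x hx => ?_
  rw [mem_rootSet]
  exact ⟨hp, by simpa using hx⟩

lemma rolle (hR : PolyIVT R) (p : R[X]) (a b : R) (hab : a < b) (ha : p.eval a = 0)
    (hb : p.eval b = 0) : ∃ c, a < c ∧ c < b ∧ p.derivative.eval c = 0 := by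
  by_cases hp : p = 0
  · subst hp
    exact ⟨(a + b) / 2, by linarith, by linarith, by simp⟩
  -- next root
  have hf : ({x | p.eval x = 0} ∩ {t | a < t}).Finite := (roots_finite p hp).inter_of_left _
  obtain ⟨b', ⟨hb', hab'⟩, hmin⟩ := Set.exists_min_image _ id hf ⟨b, hb, hab⟩
  have hb'b : b' ≤ b := hmin b ⟨hb, hab⟩
  simp only [Set.mem_setOf_eq] at hb' hab'
  obtain ⟨u, hu, hua⟩ := exists_eq_pow_rootMultiplicity_mul_and_not_dvd p hp a
  set m := rootMultiplicity a p
  have hu0 : u ≠ 0 := by rintro rfl; simp at hua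
  obtain ⟨q, hq, hqb⟩ := exists_eq_pow_rootMultiplicity_mul_and_not_dvd u hu0 b'
  set n := rootMultiplicity b' u
  rw [dvd_iff_isRoot, IsRoot.def] at hua hqb
  have hm : m ≠ 0 := by
    intro h0
    rw [h0, pow_zero, one_mul] at hu
    rw [hu] at ha; exact hua ha
  have hn : n ≠ 0 := by
    intro h0
    rw [h0, pow_zero, one_mul] at hq
    rw [hu] at hb'
    simp only [eval_mul, eval_pow, eval_sub, eval_X, eval_C] at hb'
    rcases mul_eq_zero.1 hb' with h | h
    · have := pow_eq_zero_iff hm |>.1 h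
      linarith
    · rw [hq] at h; exact hqb h
  have hqa : q.eval a ≠ 0 := by
    intro h0; apply hua; rw [hq]; simp [h0]
  have hqab : 0 < q.eval a * q.eval b' := by
    by_contra hcon
    push Not at hcon
    have : q.eval a * q.eval b' < 0 := lt_of_le_of_ne hcon (mul_ne_zero hqa hqb)
    obtain ⟨c, hac, hcb, hc⟩ := hR q a b' hab' this
    have : b' ≤ c := hmin c ⟨by rw [Set.mem_setOf_eq, hu, hq]; simp [hc], hac⟩
    linarith
  obtain ⟨m, hm'⟩ : ∃ k, m = k + 1 := Nat.exists_eq_succ_of_ne_zero hm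
  obtain ⟨n, hn'⟩ : ∃ k, n = k + 1 := Nat.exists_eq_succ_of_ne_zero hn
  rw [hn'] at hq
  rw [hm'] at hu
  let w : R[X] := C ((m : R) + 1) * (X - C b') * q + C ((n : R) + 1) * (X - C a) * q +
    (X - C a) * (X - C b') * derivative q
  have hw : derivative p = (X - C a) ^ m * (X - C b') ^ n * w := by
    rw [hu, hq]
    simp only [derivative_mul, derivative_X_sub_C_pow, w]
    simp only [Nat.cast_add, Nat.cast_one, add_tsub_cancel_right, map_add, map_natCast, map_one]
    ring
  have hwab : w.eval a * w.eval b' < 0 := by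
    simp only [w, eval_add, eval_mul, eval_sub, eval_X, eval_C, sub_self]
    have h1 : (0 : R) < (m : R) + 1 := by positivity
    have h2 : (0 : R) < (n : R) + 1 := by positivity
    have h3 : 0 < b' - a := by linarith
    have : 0 < ((m : R) + 1) * ((n : R) + 1) * ((b' - a) * (b' - a)) * (q.eval a * q.eval b') := by
      positivity
    nlinarith
  obtain ⟨c, hac, hcb, hc⟩ := hR w a b' hab' hwab
  exact ⟨c, hac, by linarith, by rw [hw]; simp [hc]⟩

lemma mvt (hR : PolyIVT R) (p : R[X]) (a b : R) (hab : a < b) :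
    ∃ c, a < c ∧ c < b ∧ p.eval b - p.eval a = p.derivative.eval c * (b - a) := by
  have h0 : b - a ≠ 0 := by linarith
  set s := (p.eval b - p.eval a) / (b - a) with hs
  obtain ⟨c, h1, h2, h3⟩ := rolle hR (p - C (p.eval a) - C s * (X - C a)) a b hab (by simp) (by
    simp [hs]; field_simp; ring)
  refine ⟨c, h1, h2, ?_⟩
  simp at h3
  have : p.derivative.eval c = s := by linarith
  rw [this, hs]; field_simp

lemma mono_of_deriv (hR : PolyIVT R) (p : R[X]) (a b : R) (hab : a ≤ b)
    (h : ∀ c, a < c → c < b → 0 ≤ p.derivative.eval c) : p.eval a ≤ p.eval b := by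
  rcases hab.eq_or_lt with rfl | hab
  · exact le_rfl
  obtain ⟨c, h1, h2, h3⟩ := mvt hR p a b hab
  nlinarith [mul_nonneg (h c h1 h2) (sub_nonneg.2 hab.le)]

lemma anti_of_deriv (hR : PolyIVT R) (p : R[X]) (a b : R) (hab : a ≤ b)
    (h : ∀ c, a < c → c < b → p.derivative.eval c ≤ 0) : p.eval b ≤ p.eval a := by
  have := mono_of_deriv hR (-p) a b hab (by simpa using h)
  simpa using this

lemma thom_convex (hR : PolyIVT R) : ∀ (n : ℕ) (p : R[X]), p.natDegree ≤ n → ∀ x x' : R, x ≤ x' →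
    (∀ k, SignType.sign ((derivative^[k] p).eval x) = SignType.sign ((derivative^[k] p).eval x')) →
    ∀ t, x ≤ t → t ≤ x' → SignType.sign (p.eval t) = SignType.sign (p.eval x) := by
  intro n
  induction n with
  | zero =>
    intro p hp x x' _ _ t _ _
    rw [eq_C_of_natDegree_le_zero hp]; simp
  | succ n ih =>
    intro p hp x x' hx h t h1 h2
    have hd : (derivative p).natDegree ≤ n := (natDegree_derivative_le p).trans (by omega)
    have hder := ih (derivative p) hd x x' hx (fun k => h (k + 1))
    have h0 := h 0
    simp only [Function.iterate_zero, id] at h0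
    have hmono : ∀ {a b : R}, a ≤ b → SignType.sign a ≤ SignType.sign b :=
      fun hab => SignType.sign.monotone hab
    rcases lt_trichotomy ((derivative p).eval x) 0 with hs | hs | hs
    · have hneg : ∀ t, x ≤ t → t ≤ x' → (derivative p).eval t ≤ 0 := by
        intro t h1 h2
        have := hder t h1 h2
        rw [sign_neg hs, sign_eq_neg_one_iff] at this
        exact this.le
      have a1 := hmono (anti_of_deriv hR p x t h1 fun c hc1 hc2 => hneg c hc1.le (by linarith))
      have a2 := hmono (anti_of_deriv hR p t x' h2 fun c hc1 hc2 => hneg c (by linarith) hc2.le)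
      rw [← h0] at a2
      exact le_antisymm a1 a2
    · have hz : ∀ t, x ≤ t → t ≤ x' → (derivative p).eval t = 0 := by
        intro t h1 h2
        have := hder t h1 h2
        rwa [hs, sign_zero, sign_eq_zero_iff] at this
      have a1 := hmono (anti_of_deriv hR p x t h1 fun c hc1 hc2 => (hz c hc1.le (by linarith)).le)
      have a2 := hmono (mono_of_deriv hR p x t h1 fun c hc1 hc2 => (hz c hc1.le (by linarith)).ge)
      exact le_antisymm a1 a2
    · have hpos : ∀ t, x ≤ t → t ≤ x' → 0 ≤ (derivative p).eval t := by
        intro t h1 h2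
        have := hder t h1 h2
        rw [sign_pos hs, sign_eq_one_iff] at this
        exact this.le
      have a1 := hmono (mono_of_deriv hR p x t h1 fun c hc1 hc2 => hpos c hc1.le (by linarith))
      have a2 := hmono (mono_of_deriv hR p t x' h2 fun c hc1 hc2 => hpos c (by linarith) hc2.le)
      rw [← h0] at a2
      exact le_antisymm a2 a1

variable {R' : Type} [Field R'] [LinearOrder R'] [IsStrictOrderedRing R']

lemma thom_order (hR : PolyIVT R) (hR' : PolyIVT R') : ∀ (n : ℕ) (p : R[X]) (P : R'[X]),
    p.natDegree ≤ n → P.natDegree ≤ n → ∀ (x x' : R) (y y' : R'), x ≤ x' → y' ≤ y →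
    (∀ k, SignType.sign ((derivative^[k] p).eval x) = SignType.sign ((derivative^[k] P).eval y)) →
    (∀ k, SignType.sign ((derivative^[k] p).eval x') = SignType.sign ((derivative^[k] P).eval y')) →
    (∀ k, SignType.sign ((derivative^[k] p).eval x) = SignType.sign ((derivative^[k] p).eval x')) := by
  intro n
  induction n with
  | zero =>
    intro p P hp hP x x' y y' _ _ h h' k
    rw [eq_C_of_natDegree_le_zero hp]
    cases k with
    | zero => simp
    | succ k => rw [Function.iterate_succ_apply]; simp
  | succ n ih =>
    intro p P hp hP x x' y y' hx hy h h'
    have hd : (derivative p).natDegree ≤ n := (natDegree_derivative_le p).trans (by omega)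
    have hD : (derivative P).natDegree ≤ n := (natDegree_derivative_le P).trans (by omega)
    have key := ih (derivative p) (derivative P) hd hD x x' y y' hx hy
      (fun k => h (k + 1)) (fun k => h' (k + 1))
    have c1 := thom_convex hR n _ hd x x' hx key
    have c2 := thom_convex hR' n _ hD y' y hy (fun k => by
      have e1 := h (k + 1)
      have e2 := h' (k + 1)
      have e3 := key k
      simp only [Function.iterate_succ_apply] at e1 e2
      rw [← e1, ← e2, e3])
    have hmono : ∀ {a b : R}, a ≤ b → SignType.sign a ≤ SignType.sign b :=
      fun hab => SignType.sign.monotone hab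
    have hmono' : ∀ {a b : R'}, a ≤ b → SignType.sign a ≤ SignType.sign b :=
      fun hab => SignType.sign.monotone hab
    have e1 := h 0
    have e2 := h' 0
    have f1 := h 1
    have f2 := h' 1
    have f3 := key 0
    simp only [Function.iterate_zero, id, Function.iterate_one] at e1 e2 f1 f2 f3
    intro k
    cases k with
    | succ k => exact key k
    | zero =>
    simp only [Function.iterate_zero, id]
    rcases le_total ((derivative p).eval x) 0 with hs | hs
    · have hneg : ∀ t, x ≤ t → t ≤ x' → (derivative p).eval t ≤ 0 := by
        intro t h1 h2
        have := c1 t h1 h2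
        rw [← not_lt, ← sign_eq_one_iff] at hs ⊢
        rwa [this]
      have hneg' : ∀ t, y' ≤ t → t ≤ y → (derivative P).eval t ≤ 0 := by
        intro t h1 h2
        have := c2 t h1 h2
        rw [← not_lt, ← sign_eq_one_iff] at hs ⊢
        rwa [this, ← f2, ← f3]
      have a1 := hmono (anti_of_deriv hR p x x' hx fun c hc1 hc2 => hneg c hc1.le hc2.le)
      have a2 := hmono' (anti_of_deriv hR' P y' y hy fun c hc1 hc2 => hneg' c hc1.le hc2.le)
      rw [← e1, ← e2] at a2
      exact le_antisymm a2 a1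
    · have hpos : ∀ t, x ≤ t → t ≤ x' → 0 ≤ (derivative p).eval t := by
        intro t h1 h2
        have := c1 t h1 h2
        rw [← not_lt, ← sign_eq_neg_one_iff] at hs ⊢
        rwa [this]
      have hpos' : ∀ t, y' ≤ t → t ≤ y → 0 ≤ (derivative P).eval t := by
        intro t h1 h2
        have := c2 t h1 h2
        rw [← not_lt, ← sign_eq_neg_one_iff] at hs ⊢
        rwa [this, ← f2, ← f3]
      have a1 := hmono (mono_of_deriv hR p x x' hx fun c hc1 hc2 => hpos c hc1.le hc2.le)
      have a2 := hmono' (mono_of_deriv hR' P y' y hy fun c hc1 hc2 => hpos' c hc1.le hc2.le)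
      rw [← e1, ← e2] at a2
      exact le_antisymm a1 a2

lemma thom_strict (hR : PolyIVT R) (hR' : PolyIVT R') (p : R[X]) (P : R'[X]) (hp : p ≠ 0)
    (x x' : R) (y y' : R') (hx : x < x')
    (h : ∀ k, SignType.sign ((derivative^[k] p).eval x) = SignType.sign ((derivative^[k] P).eval y))
    (h' : ∀ k, SignType.sign ((derivative^[k] p).eval x') =
      SignType.sign ((derivative^[k] P).eval y'))
    (h0 : p.eval x = 0 ∨ p.eval x' = 0) : y < y' := by
  by_contra hcon
  push Not at hcon
  have key := thom_order hR hR' (max p.natDegree P.natDegree) p P (le_max_left _ _) (le_max_right _ _)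
    x x' y y' hx.le hcon h h'
  have hc := thom_convex hR _ p le_rfl x x' hx.le key
  have hx0 : SignType.sign (p.eval x) = 0 := by
    rcases h0 with h0 | h0
    · rw [h0, sign_zero]
    · have := key 0
      simp only [Function.iterate_zero, id] at this
      rw [this, h0, sign_zero]
  apply hp
  apply eq_zero_of_infinite_isRoot
  refine (Set.Icc_infinite hx).mono ?_
  intro t ht
  have := hc t ht.1 ht.2
  rw [hx0, sign_eq_zero_iff] at this
  exact this

lemma sign_eq_of_no_root (hR : PolyIVT R) (p : R[X]) (a b : R) (hab : a ≤ b)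
    (h : ∀ c, a ≤ c → c ≤ b → p.eval c ≠ 0) :
    SignType.sign (p.eval a) = SignType.sign (p.eval b) := by
  rcases hab.eq_or_lt with rfl | hab
  · rfl
  have ha := h a le_rfl hab.le
  have hb := h b hab.le le_rfl
  have hn : ¬ (p.eval a * p.eval b < 0) := by
    intro hlt
    obtain ⟨c, h1, h2, h3⟩ := hR p a b hab hlt
    exact h c h1.le h2.le h3
  rcases lt_or_gt_of_ne ha with h1 | h1 <;> rcases lt_or_gt_of_ne hb with h2 | h2
  · rw [sign_neg h1, sign_neg h2]
  · exact absurd (mul_neg_of_neg_of_pos h1 h2) hn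
  · exact absurd (mul_neg_of_pos_of_neg h1 h2) hn
  · rw [sign_pos h1, sign_pos h2]

end Thom

section HStep
open Polynomial

structure HSetup {R1 R2 : Type} [Field R1] [LinearOrder R1] [IsStrictOrderedRing R1]
    [Field R2] [LinearOrder R2] [IsStrictOrderedRing R2]
    (E : R1 → R2 → Prop) (Z1 : Set R1) (Z2 : Set R2) (p : R1[X]) (P : R2[X]) : Prop where
  ivt1 : PolyIVT R1
  ivt2 : PolyIVT R2
  fin1 : Z1.Finite
  fin2 : Z2.Finite
  tot1 : ∀ x, ∃ y, E x y
  tot2 : ∀ y, ∃ x, E x y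
  mem : ∀ x y, E x y → (x ∈ Z1 ↔ y ∈ Z2)
  ord : ∀ x y x' y', E x y → E x' y' → (x ∈ Z1 ∨ x' ∈ Z1) → (x < x' ↔ y < y')
  hp : ∀ x y, E x y → x ∈ Z1 → SignType.sign (p.eval x) = SignType.sign (P.eval y)
  infL : ∀ M1 M2, ∃ x, x < M1 ∧ ∃ y, y < M2 ∧
    SignType.sign (p.eval x) = SignType.sign (P.eval y)
  infR : ∀ M1 M2, ∃ x, M1 < x ∧ ∃ y, M2 < y ∧
    SignType.sign (p.eval x) = SignType.sign (P.eval y)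
  d1 : ∀ t, p.derivative.eval t = 0 → t ∈ Z1
  d2 : ∀ t, P.derivative.eval t = 0 → t ∈ Z2
  dfin : {x | P.eval x = 0}.Finite
  dfin1 : {x | p.eval x = 0}.Finite

namespace HSetup
variable {R1 R2 : Type} [Field R1] [LinearOrder R1] [IsStrictOrderedRing R1]
    [Field R2] [LinearOrder R2] [IsStrictOrderedRing R2]
    {E : R1 → R2 → Prop} {Z1 : Set R1} {Z2 : Set R2} {p : R1[X]} {P : R2[X]}

lemma swap (h : HSetup E Z1 Z2 p P) : HSetup (fun y x => E x y) Z2 Z1 P p where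
  ivt1 := h.ivt2
  ivt2 := h.ivt1
  fin1 := h.fin2
  fin2 := h.fin1
  tot1 := h.tot2
  tot2 := h.tot1
  mem := fun x y hxy => (h.mem _ _ hxy).symm
  ord := fun x y x' y' h1 h2 h3 => (h.ord _ _ _ _ h1 h2 (by
    rwa [h.mem _ _ h1, h.mem _ _ h2])).symm
  hp := fun x y h1 h2 => (h.hp _ _ h1 ((h.mem _ _ h1).2 h2)).symm
  infL := fun M1 M2 => by
    obtain ⟨x, hx, y, hy, hs⟩ := h.infL M2 M1
    exact ⟨y, hy, x, hx, hs.symm⟩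
  infR := fun M1 M2 => by
    obtain ⟨x, hx, y, hy, hs⟩ := h.infR M2 M1
    exact ⟨y, hy, x, hx, hs.symm⟩
  d1 := h.d2
  d2 := h.d1
  dfin := h.dfin1
  dfin1 := h.dfin

lemma neg (h : HSetup E Z1 Z2 p P) : HSetup E Z1 Z2 (-p) (-P) where
  ivt1 := h.ivt1
  ivt2 := h.ivt2
  fin1 := h.fin1
  fin2 := h.fin2
  tot1 := h.tot1
  tot2 := h.tot2
  mem := h.mem
  ord := h.ord
  hp := fun x y h1 h2 => by
    rw [eval_neg, eval_neg, Left.sign_neg, Left.sign_neg, h.hp x y h1 h2]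
  infL := fun M1 M2 => by
    obtain ⟨x, hx, y, hy, hs⟩ := h.infL M1 M2
    exact ⟨x, hx, y, hy, by rw [eval_neg, eval_neg, Left.sign_neg, Left.sign_neg, hs]⟩
  infR := fun M1 M2 => by
    obtain ⟨x, hx, y, hy, hs⟩ := h.infR M1 M2
    exact ⟨x, hx, y, hy, by rw [eval_neg, eval_neg, Left.sign_neg, Left.sign_neg, hs]⟩
  d1 := fun t ht => h.d1 t (by simpa using ht)
  d2 := fun t ht => h.d2 t (by simpa using ht)
  dfin := by simpa using h.dfin
  dfin1 := by simpa using h.dfin1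

lemma refl (h : HSetup E Z1 Z2 p P) : HSetup (fun x y => E (-x) (-y))
    {x | -x ∈ Z1} {x | -x ∈ Z2} (p.comp (-X)) (P.comp (-X)) where
  ivt1 := h.ivt1
  ivt2 := h.ivt2
  fin1 := h.fin1.preimage neg_injective.injOn
  fin2 := h.fin2.preimage neg_injective.injOn
  tot1 := fun x => by
    obtain ⟨y, hy⟩ := h.tot1 (-x)
    exact ⟨-y, by simpa using hy⟩
  tot2 := fun x => by
    obtain ⟨y, hy⟩ := h.tot2 (-x)
    exact ⟨-y, by simpa using hy⟩
  mem := fun x y hxy => h.mem _ _ hxy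
  ord := fun x y x' y' h1 h2 h3 => by
    have := h.ord _ _ _ _ h2 h1 h3.symm
    simpa using this
  hp := fun x y h1 h2 => by
    simpa using h.hp _ _ h1 h2
  infL := fun M1 M2 => by
    obtain ⟨x, hx, y, hy, hs⟩ := h.infR (-M1) (-M2)
    exact ⟨-x, by linarith, -y, by linarith, by simpa using hs⟩
  infR := fun M1 M2 => by
    obtain ⟨x, hx, y, hy, hs⟩ := h.infL (-M1) (-M2)
    exact ⟨-x, by linarith, -y, by linarith, by simpa using hs⟩
  d1 := fun t ht => h.d1 _ (by simpa [derivative_comp] using ht)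
  d2 := fun t ht => h.d2 _ (by simpa [derivative_comp] using ht)
  dfin := by
    have := h.dfin.preimage (f := fun x => -x) neg_injective.injOn
    simpa using this
  dfin1 := by
    have := h.dfin1.preimage (f := fun x => -x) neg_injective.injOn
    simpa using this

lemma left (h : HSetup E Z1 Z2 p P) (x : R1) (y0 : R2) (hE : E x y0) (hx : x ∉ Z1)
    (hd : 0 < p.derivative.eval x)
    (hs : SignType.sign (p.eval x) < SignType.sign (P.eval y0)) :
    ∃ y, SignType.sign (p.eval x) = SignType.sign (P.eval y) ∧
      ∀ t ∈ Z2, (y < t ↔ y0 < t) ∧ (t < y ↔ t < y0) := by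
  have hpx : p.eval x ≤ 0 := by
    by_contra hc
    rw [sign_pos (not_le.1 hc)] at hs
    exact absurd hs (not_lt.2 (by cases SignType.sign (P.eval y0) <;> decide))
  have hy0 : y0 ∉ Z2 := fun hh => hx ((h.mem _ _ hE).2 hh)
  -- monotonicity tool
  have mono : ∀ z, z < x → (∀ t ∈ Z1, t < x → t ≤ z) → p.eval z < p.eval x := by
    intro z hz hno
    obtain ⟨c, h1, h2, h3⟩ := mvt h.ivt1 p z x hz
    have := sign_eq_of_no_root h.ivt1 p.derivative c x h2.le (fun t ht1 ht2 ht0 => by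
      have hm := h.d1 t ht0
      rcases ht2.eq_or_lt with rfl | ht2
      · exact hx hm
      · have := hno t hm ht2
        linarith)
    rw [sign_pos hd, sign_eq_one_iff] at this
    have := mul_pos this (sub_pos.2 hz)
    linarith
  have key : ∃ y1, y1 < y0 ∧ P.eval y1 < 0 ∧ ∀ t ∈ Z2, y1 < t → y0 < t := by
    rcases finite_left Z2 h.fin2 y0 with ⟨α, hα, hαy, hmax⟩ | hnone
    · obtain ⟨xα, hxα⟩ := h.tot2 α
      have hm := (h.mem _ _ hxα).2 hα
      have hlt : xα < x := (h.ord _ _ _ _ hxα hE (Or.inl hm)).2 hαy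
      have h1 := mono xα hlt (fun t ht htx => by
        obtain ⟨yt, hyt⟩ := h.tot1 t
        have e1 := (h.ord _ _ _ _ hyt hE (Or.inl ht)).1 htx
        have e2 := hmax yt ((h.mem _ _ hyt).1 ht) e1
        by_contra hc
        have e3 := (h.ord _ _ _ _ hxα hyt (Or.inl hm)).1 (not_le.1 hc)
        exact absurd e3 (not_lt.2 e2))
      refine ⟨α, hαy, ?_, fun t ht hαt => ?_⟩
      · have := h.hp _ _ hxα hm
        rw [sign_neg (by linarith : p.eval xα < 0)] at this
        exact sign_eq_neg_one_iff.1 this.symm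
      · by_contra hc
        rcases (not_lt.1 hc).eq_or_lt with rfl | hc
        · exact hy0 ht
        · exact absurd hαt (not_lt.2 (hmax t ht hc))
    · have hno : ∀ t ∈ Z1, ¬ t < x := by
        intro t ht htx
        obtain ⟨yt, hyt⟩ := h.tot1 t
        exact hnone yt ((h.mem _ _ hyt).1 ht) ((h.ord _ _ _ _ hyt hE (Or.inl ht)).1 htx)
      obtain ⟨x1, hx1, y1, hy1, hs1⟩ := h.infL x y0
      have h1 := mono x1 hx1 (fun t ht htx => absurd htx (hno t ht))
      refine ⟨y1, hy1, ?_, fun t ht _ => ?_⟩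
      · rw [sign_neg (by linarith : p.eval x1 < 0)] at hs1
        exact sign_eq_neg_one_iff.1 hs1.symm
      · by_contra hc
        rcases (not_lt.1 hc).eq_or_lt with rfl | hc
        · exact hy0 ht
        · exact hnone t ht hc
  obtain ⟨y1, hy1, hP1, hno⟩ := key
  suffices hsuf : ∃ y, y1 < y ∧ y ≤ y0 ∧ SignType.sign (p.eval x) = SignType.sign (P.eval y) by
    obtain ⟨y, h1, h2, h3⟩ := hsuf
    refine ⟨y, h3, fun t ht => ⟨⟨fun hh => hno t ht (h1.trans hh), fun hh => h2.trans_lt hh⟩,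
      fun hh => hh.trans_le h2, fun hh => ?_⟩⟩
    by_contra hc
    exact absurd (hno t ht (h1.trans_le (not_lt.1 hc))) (not_lt.2 hh.le)
  rcases hpx.eq_or_lt with hp0 | hp0
  · rw [hp0, sign_zero] at hs ⊢
    have hPy : 0 < P.eval y0 := by
      by_contra hc
      rcases (not_lt.1 hc).eq_or_lt with hc | hc
      · rw [hc, sign_zero] at hs; exact absurd hs (lt_irrefl _)
      · rw [sign_neg hc] at hs; exact absurd hs (by decide)
    obtain ⟨c, h1, h2, h3⟩ := h.ivt2 P y1 y0 hy1 (mul_neg_of_neg_of_pos hP1 hPy)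
    exact ⟨c, h1, h2.le, by rw [h3, sign_zero]⟩
  · obtain ⟨y, h1, h2, h3⟩ := finite_gap _ h.dfin y1 y0 hy1
    refine ⟨y, h1, h2.le, ?_⟩
    rw [sign_neg hp0, ← sign_neg hP1]
    refine sign_eq_of_no_root h.ivt2 P y1 y h1.le (fun c hc1 hc2 hc0 => ?_)
    rcases hc1.eq_or_lt with rfl | hc1
    · linarith
    · exact absurd (h3 c hc0 hc1) (not_lt.2 hc2)

lemma step (h : HSetup E Z1 Z2 p P) (x : R1) (y0 : R2) (hE : E x y0) :
    ∃ y, SignType.sign (p.eval x) = SignType.sign (P.eval y) ∧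
      (y = y0 ∨ y0 ∉ Z2 ∧ ∀ t ∈ Z2, (y < t ↔ y0 < t) ∧ (t < y ↔ t < y0)) := by
  by_cases hx : x ∈ Z1
  · exact ⟨y0, h.hp _ _ hE hx, Or.inl rfl⟩
  have hy0 : y0 ∉ Z2 := fun hh => hx ((h.mem _ _ hE).2 hh)
  rcases eq_or_ne (SignType.sign (p.eval x)) (SignType.sign (P.eval y0)) with hs | hs
  · exact ⟨y0, hs, Or.inl rfl⟩
  have hd : p.derivative.eval x ≠ 0 := fun h0 => hx (h.d1 x h0)
  rcases lt_or_gt_of_ne hs with hs | hs <;> rcases lt_or_gt_of_ne hd with hd | hd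
  · obtain ⟨y, h1, h2⟩ := h.refl.left (-x) (-y0) (by simpa using hE) (by simpa using hx)
      (by simpa [derivative_comp] using hd) (by simpa using hs)
    refine ⟨-y, by simpa using h1, Or.inr ⟨hy0, fun t ht => ?_⟩⟩
    have := h2 (-t) (by simpa using ht)
    constructor
    · rw [neg_lt, this.2, neg_lt_neg_iff]
    · rw [lt_neg, this.1, neg_lt_neg_iff]
  · obtain ⟨y, h1, h2⟩ := h.left x y0 hE hx hd hs
    exact ⟨y, h1, Or.inr ⟨hy0, h2⟩⟩
  · obtain ⟨y, h1, h2⟩ := h.neg.left x y0 hE hx (by simpa using hd) (by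
      rw [eval_neg, eval_neg, Left.sign_neg, Left.sign_neg]
      revert hs
      cases SignType.sign (p.eval x) <;> cases SignType.sign (P.eval y0) <;> decide)
    refine ⟨y, ?_, Or.inr ⟨hy0, h2⟩⟩
    rw [eval_neg, eval_neg, Left.sign_neg, Left.sign_neg] at h1
    exact neg_injective h1
  · obtain ⟨y, h1, h2⟩ := h.neg.refl.left (-x) (-y0) (by simpa using hE) (by simpa using hx)
      (by simpa [derivative_comp] using hd) (by
      simp only [eval_comp, eval_neg, eval_X, neg_neg, Left.sign_neg]
      revert hs
      cases SignType.sign (p.eval x) <;> cases SignType.sign (P.eval y0) <;> decide)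
    refine ⟨-y, ?_, Or.inr ⟨hy0, fun t ht => ?_⟩⟩
    · simp only [eval_comp, eval_neg, eval_X, neg_neg, Left.sign_neg] at h1
      exact neg_injective h1
    have := h2 (-t) (by simpa using ht)
    constructor
    · rw [neg_lt, this.2, neg_lt_neg_iff]
    · rw [lt_neg, this.1, neg_lt_neg_iff]

end HSetup
end HStep

section HInd
open Polynomial

lemma cell_sign {R : Type} [Field R] [LinearOrder R] [IsStrictOrderedRing R] (hR : PolyIVT R)
    (Z : Set R) (q : R[X]) (hq : ∀ t, q.eval t = 0 → t ∈ Z) (y y0 : R) (hy0 : y0 ∉ Z)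
    (h : ∀ t ∈ Z, (y < t ↔ y0 < t) ∧ (t < y ↔ t < y0)) :
    SignType.sign (q.eval y) = SignType.sign (q.eval y0) := by
  have hne : ∀ t ∈ Z, t ≠ y0 := fun t ht h0 => hy0 (h0 ▸ ht)
  rcases le_total y y0 with hy | hy
  · refine sign_eq_of_no_root hR q y y0 hy fun c h1 h2 h0 => ?_
    have hc := hq c h0
    have := (h c hc).2.2 (lt_of_le_of_ne h2 (hne c hc))
    exact absurd this (not_lt.2 h1)
  · refine (sign_eq_of_no_root hR q y0 y hy fun c h1 h2 h0 => ?_).symm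
    have hc := hq c h0
    have := (h c hc).1.2 (lt_of_le_of_ne h1 (hne c hc).symm)
    exact absurd this (not_lt.2 h2)

lemma pos_at_top {R : Type} [Field R] [LinearOrder R] [IsStrictOrderedRing R] :
    ∀ (n : ℕ) (q : R[X]), q.natDegree = n → 0 < q.leadingCoeff →
    ∃ M δ : R, 0 < δ ∧ ∀ x, M < x → δ ≤ q.eval x := by
  intro n
  induction n with
  | zero =>
    intro q hq hl
    refine ⟨0, q.leadingCoeff, hl, fun x _ => ?_⟩
    rw [eq_C_of_natDegree_eq_zero hq]; simp
  | succ n ih =>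
    intro q hq hl
    have hd : q.divX.natDegree = n := by rw [natDegree_divX_eq_natDegree_tsub_one, hq]; rfl
    have hl' : 0 < q.divX.leadingCoeff := by
      rw [leadingCoeff, hd, coeff_divX, ← hq]; exact hl
    obtain ⟨M, δ, hδ, h⟩ := ih _ hd hl'
    refine ⟨max (max M 0) ((1 + |q.coeff 0|) / δ), 1, one_pos, fun x hx => ?_⟩
    rw [max_lt_iff, max_lt_iff, div_lt_iff₀ hδ] at hx
    have h1 := h x hx.1.1
    have h2 := mul_le_mul_of_nonneg_right h1 hx.1.2.le
    have h3 := neg_abs_le (q.coeff 0)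
    conv_rhs => rw [← divX_mul_X_add q]
    simp only [eval_add, eval_mul, eval_X, eval_C]
    linarith

lemma sign_at_top {R : Type} [Field R] [LinearOrder R] [IsStrictOrderedRing R] (q : R[X]) :
    ∃ M : R, ∀ x, M < x → SignType.sign (q.eval x) = SignType.sign q.leadingCoeff := by
  rcases lt_trichotomy q.leadingCoeff 0 with h | h | h
  · obtain ⟨M, δ, hδ, hM⟩ := pos_at_top _ (-q) rfl (by rw [leadingCoeff_neg]; linarith)
    refine ⟨M, fun x hx => ?_⟩
    have := hM x hx
    rw [eval_neg] at this
    rw [sign_neg h, sign_neg (by linarith)]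
  · rw [leadingCoeff_eq_zero] at h
    subst h
    exact ⟨0, fun x _ => by simp⟩
  · obtain ⟨M, δ, hδ, hM⟩ := pos_at_top _ q rfl h
    refine ⟨M, fun x hx => ?_⟩
    have := hM x hx
    rw [sign_pos h, sign_pos (by linarith)]

section two
variable {R1 R2 : Type} [Field R1] [LinearOrder R1] [IsStrictOrderedRing R1]
    [Field R2] [LinearOrder R2] [IsStrictOrderedRing R2]

lemma infR_pair (p : R1[X]) (P : R2[X])
    (hl : SignType.sign p.leadingCoeff = SignType.sign P.leadingCoeff) (M1 : R1) (M2 : R2) :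
    ∃ x, M1 < x ∧ ∃ y, M2 < y ∧ SignType.sign (p.eval x) = SignType.sign (P.eval y) := by
  obtain ⟨N1, h1⟩ := sign_at_top p
  obtain ⟨N2, h2⟩ := sign_at_top P
  refine ⟨max M1 N1 + 1, by linarith [le_max_left M1 N1], max M2 N2 + 1,
    by linarith [le_max_left M2 N2], ?_⟩
  rw [h1 _ (by linarith [le_max_right M1 N1]), h2 _ (by linarith [le_max_right M2 N2]), hl]

lemma infL_pair (p : R1[X]) (P : R2[X]) (hd : p.natDegree = P.natDegree)
    (hl : SignType.sign p.leadingCoeff = SignType.sign P.leadingCoeff) (M1 : R1) (M2 : R2) :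
    ∃ x, x < M1 ∧ ∃ y, y < M2 ∧ SignType.sign (p.eval x) = SignType.sign (P.eval y) := by
  obtain ⟨x, hx, y, hy, h⟩ := infR_pair (p.comp (-X)) (P.comp (-X)) (by
    rw [leadingCoeff_comp (by simp), leadingCoeff_comp (by simp), sign_mul, sign_mul, hl, hd]
    congr 1
    rcases Nat.even_or_odd P.natDegree with h | h
    · simp [h.neg_pow]
    · simp [h.neg_pow]) (-M1) (-M2)
  exact ⟨-x, by linarith, -y, by linarith, by simpa using h⟩
end two

lemma pseudo_div {A : Type} [CommRing A] (q : A[X]) (n : ℕ) (hq : q.natDegree ≤ n) :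
    ∀ (k : ℕ) (p : A[X]), p.degree < k →
      ∃ (N : ℕ) (h r : A[X]), C (q.coeff n ^ N) * p = q * h + r ∧ r.degree < n := by
  intro k
  induction k with
  | zero =>
    intro p hp
    exact ⟨0, 0, p, by simp, hp.trans_le (by exact_mod_cast Nat.zero_le n)⟩
  | succ k ih =>
    intro p hp
    by_cases hkn : k + 1 ≤ n
    · exact ⟨0, 0, p, by simp, hp.trans_le (by exact_mod_cast hkn)⟩
    have hkn : n ≤ k := by omega
    obtain ⟨N, h, r, h1, h2⟩ := ih
      (C (q.coeff n) * p - q * (C (p.coeff k) * X ^ (k - n))) (by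
      rw [degree_lt_iff_coeff_zero] at hp ⊢
      intro j hj
      rw [coeff_sub, coeff_C_mul, mul_left_comm, coeff_C_mul]
      rcases hj.eq_or_lt with rfl | hj
      · have : (q * X ^ (k - n)).coeff (n + (k - n)) = q.coeff n := coeff_mul_X_pow _ _ _
        rw [Nat.add_sub_cancel' hkn] at this
        rw [this]; ring
      · rw [hp j (by omega), mul_zero, coeff_eq_zero_of_natDegree_lt (p := q * X ^ (k - n)), mul_zero, sub_zero]
        refine lt_of_le_of_lt natDegree_mul_le ?_
        have := natDegree_X_pow_le (R := A) (k - n)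
        omega)
    refine ⟨N + 1, h + C (q.coeff n ^ N) * (C (p.coeff k) * X ^ (k - n)), r, ?_, h2⟩
    rw [pow_succ, C_mul]
    linear_combination h1

end HInd

section HMain
open Polynomial

lemma exists_rem {A R1 : Type} [CommRing A] [Field R1] (φ1 : A →+* R1) (p q : A[X])
    (hq : q.map φ1 ≠ 0) : ∃ (c : A) (r : A[X]), φ1 c ≠ 0 ∧
      (r.map φ1).degree < (q.map φ1).degree ∧
      ∀ (K : Type) [Field K] (φ : A →+* K) (y : K),
        (∀ i, φ1 (q.coeff i) = 0 → φ (q.coeff i) = 0) →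
        (q.map φ).eval y = 0 → φ c ^ 2 * (p.map φ).eval y = (r.map φ).eval y := by
  set n := (q.map φ1).natDegree with hn
  set q' : A[X] := ∑ i ∈ Finset.range (n + 1), C (q.coeff i) * X ^ i with hq'
  have hco : ∀ j, q'.coeff j = if j ≤ n then q.coeff j else 0 := by
    intro j
    simp [hq', coeff_C_mul, coeff_X_pow, Nat.lt_succ_iff]
  have hdeg : q'.natDegree ≤ n := by
    rw [natDegree_le_iff_coeff_eq_zero]
    intro j hj
    rw [hco, if_neg (by omega)]
  have hl : φ1 (q.coeff n) ≠ 0 := by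
    rw [← coeff_map, hn]
    exact leadingCoeff_ne_zero.2 hq
  obtain ⟨N, h, r, h1, h2⟩ := pseudo_div q' n hdeg (p.natDegree + 1) p
    (by exact_mod_cast lt_of_le_of_lt degree_le_natDegree (by exact_mod_cast Nat.lt_succ_self _))
  have hcn : q'.coeff n = q.coeff n := by rw [hco, if_pos le_rfl]
  rw [hcn] at h1
  refine ⟨q.coeff n ^ N, C (q.coeff n ^ N) * r, by rw [map_pow]; exact pow_ne_zero _ hl, ?_, ?_⟩
  · rw [degree_eq_natDegree hq, ← hn, degree_lt_iff_coeff_zero]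
    rw [degree_lt_iff_coeff_zero] at h2
    intro m hm
    rw [coeff_map, coeff_C_mul, h2 m hm, mul_zero, map_zero]
  · intro K _ φ y hz hy
    have e : q'.map φ = q.map φ := by
      ext j
      rw [coeff_map, coeff_map, hco]
      split_ifs with hj
      · rfl
      · rw [map_zero, hz j]
        rw [← coeff_map]
        exact coeff_eq_zero_of_natDegree_lt (by omega)
    have := congrArg (fun z => (z.map φ).eval y) h1
    simp only [Polynomial.map_mul, Polynomial.map_add, map_C, eval_mul, eval_add, eval_C, e, hy,
      zero_mul, zero_add] at this
    rw [Polynomial.map_mul, map_C, eval_mul, eval_C, ← this]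
    ring

section
variable {A R1 R2 : Type} [CommRing A] [Field R1] [LinearOrder R1] [IsStrictOrderedRing R1]
    [Field R2] [LinearOrder R2] [IsStrictOrderedRing R2]

def HGood (φ1 : A →+* R1) (R2 : Type) [Field R2] [LinearOrder R2] (S : Finset A[X]) : Prop :=
  ∃ S' : Finset A, ∀ φ2 : A →+* R2, (∀ a ∈ S', SignType.sign (φ1 a) = SignType.sign (φ2 a)) →
    (∀ x, ∃ y, ∀ q ∈ S, SignType.sign ((q.map φ1).eval x) = SignType.sign ((q.map φ2).eval y)) ∧
    (∀ y, ∃ x, ∀ q ∈ S, SignType.sign ((q.map φ1).eval x) = SignType.sign ((q.map φ2).eval y))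

lemma HGood.mono {φ1 : A →+* R1} {S T : Finset A[X]} (h : HGood φ1 R2 T) (hST : S ⊆ T) :
    HGood φ1 R2 S := by
  obtain ⟨S', hS'⟩ := h
  refine ⟨S', fun φ2 h2 => ?_⟩
  obtain ⟨a, b⟩ := hS' φ2 h2
  refine ⟨fun x => ?_, fun y => ?_⟩
  · obtain ⟨y, hy⟩ := a x
    exact ⟨y, fun q hq => hy q (hST hq)⟩
  · obtain ⟨x, hx⟩ := b y
    exact ⟨x, fun q hq => hx q (hST hq)⟩

lemma coeff_sign {φ1 : A →+* R1} {φ2 : A →+* R2} {q : A[X]}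
    (h : ∀ a ∈ q.coeffs, SignType.sign (φ1 a) = SignType.sign (φ2 a)) (i : ℕ) :
    SignType.sign (φ1 (q.coeff i)) = SignType.sign (φ2 (q.coeff i)) := by
  by_cases h0 : q.coeff i = 0
  · rw [h0]; simp
  · exact h _ (coeff_mem_coeffs h0)

lemma coeff_zero_iff {φ1 : A →+* R1} {φ2 : A →+* R2} {q : A[X]}
    (h : ∀ a ∈ q.coeffs, SignType.sign (φ1 a) = SignType.sign (φ2 a)) (i : ℕ) :
    (q.map φ1).coeff i = 0 ↔ (q.map φ2).coeff i = 0 := by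
  rw [coeff_map, coeff_map, ← sign_eq_zero_iff, coeff_sign h i, sign_eq_zero_iff]

lemma map_zero_iff' {φ1 : A →+* R1} {φ2 : A →+* R2} {q : A[X]}
    (h : ∀ a ∈ q.coeffs, SignType.sign (φ1 a) = SignType.sign (φ2 a)) :
    q.map φ1 = 0 ↔ q.map φ2 = 0 := by
  rw [Polynomial.ext_iff, Polynomial.ext_iff]
  simp only [coeff_zero]
  exact forall_congr' fun i => coeff_zero_iff h i

lemma map_natDegree_eq {φ1 : A →+* R1} {φ2 : A →+* R2} {q : A[X]}
    (h : ∀ a ∈ q.coeffs, SignType.sign (φ1 a) = SignType.sign (φ2 a)) :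
    (q.map φ1).natDegree = (q.map φ2).natDegree := by
  apply le_antisymm
  · rw [natDegree_le_iff_coeff_eq_zero]
    intro j hj
    rw [coeff_zero_iff h]
    exact coeff_eq_zero_of_natDegree_lt hj
  · rw [natDegree_le_iff_coeff_eq_zero]
    intro j hj
    rw [← coeff_zero_iff h]
    exact coeff_eq_zero_of_natDegree_lt hj

lemma map_iter_deriv {K : Type} [Field K] (φ : A →+* K) (q : A[X]) (k : ℕ) :
    derivative^[k] (q.map φ) = (derivative^[k] q).map φ := iterate_derivative_map q φ k

lemma sign_sq_mul {K : Type} [Field K] [LinearOrder K] [IsStrictOrderedRing K] {c v : K}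
    (hc : c ≠ 0) : SignType.sign (c ^ 2 * v) = SignType.sign v := by
  rw [sign_mul, sign_pos (by positivity), one_mul]

open Classical in
lemma hstep (h1 : PolyIVT R1) (h2 : PolyIVT R2) (φ1 : A →+* R1) (p : A[X])
    (hp : 0 < (p.map φ1).natDegree) (Q : Finset A[X]) (hpQ : derivative p ∈ Q)
    (hQ : ∀ q ∈ Q, derivative q ∈ Q) (S : Finset A[X]) (hQS : Q ⊆ S) (c : A[X] → A)
    (r : A[X] → A[X]) (hr : ∀ q ∈ Q, q.map φ1 ≠ 0 → r q ∈ S)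
    (hc : ∀ q ∈ Q, q.map φ1 ≠ 0 → φ1 (c q) ≠ 0)
    (hcr : ∀ q ∈ Q, q.map φ1 ≠ 0 → ∀ (K : Type) [Field K] (φ : A →+* K) (y : K),
        (∀ i, φ1 (q.coeff i) = 0 → φ (q.coeff i) = 0) →
        (q.map φ).eval y = 0 → φ (c q) ^ 2 * (p.map φ).eval y = ((r q).map φ).eval y)
    (hS : HGood φ1 R2 S) : HGood φ1 R2 (insert p Q) := by
  classical
  obtain ⟨S', hS'⟩ := hS
  refine ⟨S' ∪ Q.biUnion coeffs ∪ p.coeffs ∪ Q.image c, fun φ2 hφ => ?_⟩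
  obtain ⟨t1, t2⟩ := hS' φ2 (fun a ha => hφ a (by simp [ha]))
  have hpc : ∀ a ∈ p.coeffs, SignType.sign (φ1 a) = SignType.sign (φ2 a) :=
    fun a ha => hφ a (by simp [ha])
  have hQc : ∀ q ∈ Q, ∀ a ∈ q.coeffs, SignType.sign (φ1 a) = SignType.sign (φ2 a) :=
    fun q hq a ha => hφ a (by
      simp only [Finset.mem_union, Finset.mem_biUnion]
      exact Or.inl (Or.inl (Or.inr ⟨q, hq, ha⟩)))
  have hcc : ∀ q ∈ Q, SignType.sign (φ1 (c q)) = SignType.sign (φ2 (c q)) :=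
    fun q hq => hφ _ (by
      simp only [Finset.mem_union, Finset.mem_image]
      exact Or.inr ⟨q, hq, rfl⟩)
  have hQk : ∀ k, ∀ q ∈ Q, derivative^[k] q ∈ Q := by
    intro k
    induction k with
    | zero => intro q hq; exact hq
    | succ k ih => intro q hq; exact ih _ (hQ q hq)
  set E : R1 → R2 → Prop := fun x y => ∀ q ∈ S,
    SignType.sign ((q.map φ1).eval x) = SignType.sign ((q.map φ2).eval y) with hE
  set Z1 : Set R1 := {x | ∃ q ∈ Q, q.map φ1 ≠ 0 ∧ (q.map φ1).eval x = 0} with hZ1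
  set Z2 : Set R2 := {x | ∃ q ∈ Q, q.map φ2 ≠ 0 ∧ (q.map φ2).eval x = 0} with hZ2
  have hne : ∀ q ∈ Q, (q.map φ1 ≠ 0 ↔ q.map φ2 ≠ 0) := fun q hq =>
    not_congr (map_zero_iff' (hQc q hq))
  have hEz : ∀ x y, E x y → ∀ q ∈ Q, ((q.map φ1).eval x = 0 ↔ (q.map φ2).eval y = 0) := by
    intro x y hxy q hq
    rw [← sign_eq_zero_iff, hxy q (hQS hq), sign_eq_zero_iff]
  have hder : ∀ x y, E x y → ∀ q ∈ Q, ∀ k, SignType.sign ((derivative^[k] (q.map φ1)).eval x) =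
      SignType.sign ((derivative^[k] (q.map φ2)).eval y) := by
    intro x y hxy q hq k
    rw [map_iter_deriv, map_iter_deriv]
    exact hxy _ (hQS (hQk k q hq))
  have hd : (p.map φ1).natDegree = (p.map φ2).natDegree := map_natDegree_eq hpc
  have hlc : SignType.sign (p.map φ1).leadingCoeff = SignType.sign (p.map φ2).leadingCoeff := by
    rw [leadingCoeff, leadingCoeff, ← hd, coeff_map, coeff_map]
    exact coeff_sign hpc _
  have hdp1 : derivative (p.map φ1) ≠ 0 := fun h0 => by
    have := derivative_eq_zero.1 h0
    omega
  have hdp2 : derivative (p.map φ2) ≠ 0 := fun h0 => by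
    have := derivative_eq_zero.1 h0
    omega
  have hset : HSetup E Z1 Z2 (p.map φ1) (p.map φ2) := {
    ivt1 := h1
    ivt2 := h2
    fin1 := by
      have : Z1 ⊆ ⋃ q ∈ (Q.filter fun q => q.map φ1 ≠ 0), {x | (q.map φ1).eval x = 0} := by
        rintro x ⟨q, hq, hq0, hx⟩
        simp only [Set.mem_iUnion]
        exact ⟨q, by simp [hq, hq0], hx⟩
      refine Set.Finite.subset (Set.Finite.biUnion (Finset.finite_toSet _) fun q hq => ?_) this
      exact roots_finite _ (by simpa using (Finset.mem_filter.1 hq).2)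
    fin2 := by
      have : Z2 ⊆ ⋃ q ∈ (Q.filter fun q => q.map φ2 ≠ 0), {x | (q.map φ2).eval x = 0} := by
        rintro x ⟨q, hq, hq0, hx⟩
        simp only [Set.mem_iUnion]
        exact ⟨q, by simp [hq, hq0], hx⟩
      refine Set.Finite.subset (Set.Finite.biUnion (Finset.finite_toSet _) fun q hq => ?_) this
      exact roots_finite _ (by simpa using (Finset.mem_filter.1 hq).2)
    tot1 := t1
    tot2 := t2
    mem := by
      intro x y hxy
      constructor
      · rintro ⟨q, hq, hq0, hx⟩
        exact ⟨q, hq, (hne q hq).1 hq0, (hEz x y hxy q hq).1 hx⟩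
      · rintro ⟨q, hq, hq0, hx⟩
        exact ⟨q, hq, (hne q hq).2 hq0, (hEz x y hxy q hq).2 hx⟩
    ord := by
      intro x y x' y' hxy hxy' hz
      have : ∃ q ∈ Q, q.map φ1 ≠ 0 ∧ ((q.map φ1).eval x = 0 ∨ (q.map φ1).eval x' = 0) := by
        rcases hz with ⟨q, hq, hq0, hx⟩ | ⟨q, hq, hq0, hx⟩
        · exact ⟨q, hq, hq0, Or.inl hx⟩
        · exact ⟨q, hq, hq0, Or.inr hx⟩
      obtain ⟨q, hq, hq0, hx⟩ := this
      constructor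
      · intro hlt
        exact thom_strict h1 h2 _ _ hq0 x x' y y' hlt (hder _ _ hxy q hq) (hder _ _ hxy' q hq) hx
      · intro hlt
        refine thom_strict h2 h1 _ _ ((hne q hq).1 hq0) y y' x x' hlt
          (fun k => (hder _ _ hxy q hq k).symm) (fun k => (hder _ _ hxy' q hq k).symm) ?_
        rwa [← hEz _ _ hxy q hq, ← hEz _ _ hxy' q hq]
    hp := by
      rintro x y hxy ⟨q, hq, hq0, hx⟩
      have e1 := hcr q hq hq0 R1 φ1 x (fun i hi => hi) hx
      have e2 := hcr q hq hq0 R2 φ2 y (fun i hi => by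
        rw [← coeff_map] at hi ⊢
        exact (coeff_zero_iff (hQc q hq) i).1 hi) ((hEz x y hxy q hq).1 hx)
      have e3 := hxy _ (hr q hq hq0)
      have hc1 := hc q hq hq0
      have hc2 : φ2 (c q) ≠ 0 := by
        rw [← sign_ne_zero, ← hcc q hq, sign_ne_zero]; exact hc1
      rw [← e1, ← e2, sign_sq_mul hc1, sign_sq_mul hc2] at e3
      exact e3
    infL := infL_pair _ _ hd hlc
    infR := infR_pair _ _ hlc
    d1 := by
      intro t ht
      refine ⟨_, hpQ, ?_, ?_⟩ <;> rw [← derivative_map]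
      · exact hdp1
      · exact ht
    d2 := by
      intro t ht
      refine ⟨_, hpQ, ?_, ?_⟩ <;> rw [← derivative_map]
      · exact hdp2
      · exact ht
    dfin := roots_finite _ (fun h0 => hdp2 (by rw [h0, derivative_zero]))
    dfin1 := roots_finite _ (fun h0 => hdp1 (by rw [h0, derivative_zero])) }
  constructor
  · intro x
    obtain ⟨y0, hy0⟩ := t1 x
    obtain ⟨y, hy, hcell⟩ := hset.step x y0 hy0
    refine ⟨y, fun q hq => ?_⟩
    rcases Finset.mem_insert.1 hq with rfl | hq
    · exact hy
    · rw [hy0 q (hQS hq)]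
      rcases hcell with rfl | ⟨hn, hcell⟩
      · rfl
      · by_cases hq0 : q.map φ2 = 0
        · simp [hq0]
        · exact (cell_sign h2 Z2 _ (fun t ht => ⟨q, hq, hq0, ht⟩) y y0 hn hcell).symm
  · intro x
    obtain ⟨y0, hy0⟩ := t2 x
    obtain ⟨y, hy, hcell⟩ := hset.swap.step x y0 hy0
    refine ⟨y, fun q hq => ?_⟩
    rcases Finset.mem_insert.1 hq with rfl | hq
    · exact hy.symm
    · rw [← hy0 q (hQS hq)]
      rcases hcell with rfl | ⟨hn, hcell⟩
      · rfl
      · by_cases hq0 : q.map φ1 = 0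
        · simp [hq0]
        · exact (cell_sign h1 Z1 _ (fun t ht => ⟨q, hq, hq0, ht⟩) y y0 hn hcell)

lemma hbase (φ1 : A →+* R1) (S : Finset A[X]) (hS : ∀ q ∈ S, (q.map φ1).natDegree = 0) :
    HGood φ1 R2 S := by
  classical
  refine ⟨S.biUnion coeffs, fun φ2 hφ => ?_⟩
  have key : ∀ q ∈ S, ∀ x y,
      SignType.sign ((q.map φ1).eval x) = SignType.sign ((q.map φ2).eval y) := by
    intro q hq x y
    have hc : ∀ a ∈ q.coeffs, SignType.sign (φ1 a) = SignType.sign (φ2 a) :=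
      fun a ha => hφ a (Finset.mem_biUnion.2 ⟨q, hq, ha⟩)
    have e1 := hS q hq
    have e2 := e1
    rw [map_natDegree_eq hc] at e2
    rw [eq_C_of_natDegree_eq_zero e1, eq_C_of_natDegree_eq_zero e2, eval_C, eval_C, coeff_map,
      coeff_map]
    exact coeff_sign hc 0
  exact ⟨fun x => ⟨0, fun q hq => key q hq x 0⟩, fun y => ⟨0, fun q hq => key q hq 0 y⟩⟩

theorem hormander (h1 : PolyIVT R1) (h2 : PolyIVT R2) (φ1 : A →+* R1) :
    ∀ (d k : ℕ) (S : Finset A[X]), (∀ q ∈ S, (q.map φ1).natDegree ≤ d) →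
    (S.filter fun q => (q.map φ1).natDegree = d).card ≤ k → HGood φ1 R2 S := by
  classical
  intro d
  induction d with
  | zero =>
    intro k S hS _
    exact hbase φ1 S (fun q hq => Nat.le_zero.1 (hS q hq))
  | succ d ihd =>
    have hempty : ∀ S : Finset A[X], (∀ q ∈ S, (q.map φ1).natDegree ≤ d + 1) →
        (S.filter fun q => (q.map φ1).natDegree = d + 1) = ∅ → HGood φ1 R2 S := by
      intro S hS he
      refine ihd _ S (fun q hq => ?_) le_rfl
      have a := hS q hq
      have b : ¬ ((q.map φ1).natDegree = d + 1) := fun hh => by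
        have : q ∈ (S.filter fun q => (q.map φ1).natDegree = d + 1) :=
          Finset.mem_filter.2 ⟨hq, hh⟩
        rw [he] at this
        exact absurd this (Finset.notMem_empty _)
      omega
    intro k
    induction k with
    | zero =>
      intro S hS hk
      exact hempty S hS (Finset.card_eq_zero.1 (Nat.le_zero.1 hk))
    | succ k ihk =>
      intro S hS hk
      rcases (S.filter fun q => (q.map φ1).natDegree = d + 1).eq_empty_or_nonempty with he | ⟨p, hp⟩
      · exact hempty S hS he
      have hpS := (Finset.mem_filter.1 hp).1
      have hpd := (Finset.mem_filter.1 hp).2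
      set Q0 : Finset A[X] := insert (derivative p) (S.erase p) with hQ0
      set Q : Finset A[X] := Q0.biUnion fun q =>
        (Finset.range (q.natDegree + 2)).image fun j => derivative^[j] q with hQdef
      have hmemQ : ∀ q, q ∈ Q ↔ ∃ q0 ∈ Q0, ∃ j < q0.natDegree + 2, derivative^[j] q0 = q := by
        intro q
        simp [hQdef]
      have hQ0Q : Q0 ⊆ Q := fun q hq => (hmemQ q).2 ⟨q, hq, 0, by omega, rfl⟩
      have hQ : ∀ q ∈ Q, derivative q ∈ Q := by
        intro q hq
        obtain ⟨q0, hq0, j, hj, rfl⟩ := (hmemQ q).1 hq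
        rw [← Function.iterate_succ_apply' derivative]
        by_cases hj' : j + 1 < q0.natDegree + 2
        · exact (hmemQ _).2 ⟨q0, hq0, j + 1, hj', rfl⟩
        · refine (hmemQ _).2 ⟨q0, hq0, j, hj, ?_⟩
          rw [iterate_derivative_eq_zero (by omega), iterate_derivative_eq_zero (by omega)]
      have hex : ∀ q : A[X], ∃ (c : A) (r : A[X]), q.map φ1 ≠ 0 → (φ1 c ≠ 0 ∧
          (r.map φ1).degree < (q.map φ1).degree ∧
          ∀ (K : Type) [Field K] (φ : A →+* K) (y : K),
            (∀ i, φ1 (q.coeff i) = 0 → φ (q.coeff i) = 0) →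
            (q.map φ).eval y = 0 → φ c ^ 2 * (p.map φ).eval y = (r.map φ).eval y) := by
        intro q
        by_cases hq : q.map φ1 = 0
        · exact ⟨0, 0, fun h => absurd hq h⟩
        · obtain ⟨c, r, h⟩ := exists_rem φ1 p q hq
          exact ⟨c, r, fun _ => h⟩
      choose c r hcr using hex
      set S2 : Finset A[X] := Q ∪ (Q.filter fun q => q.map φ1 ≠ 0).image r with hS2
      have hdp : ((derivative p).map φ1).natDegree ≤ d := by
        rw [← derivative_map]
        have := natDegree_derivative_le (p.map φ1)
        omega
      have hQ0d : ∀ q ∈ Q0, (q.map φ1).natDegree ≤ d + 1 := by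
        intro q hq
        rcases Finset.mem_insert.1 hq with rfl | hq
        · omega
        · exact hS q (Finset.mem_of_mem_erase hq)
      have hQd : ∀ q ∈ Q, (q.map φ1).natDegree ≤ d + 1 ∧
          ((q.map φ1).natDegree = d + 1 → q ∈ Q0) := by
        intro q hq
        obtain ⟨q0, hq0, j, hj, rfl⟩ := (hmemQ q).1 hq
        rcases j with _ | j
        · exact ⟨hQ0d _ hq0, fun _ => hq0⟩
        · have a := natDegree_iterate_derivative (q0.map φ1) (j + 1)
          rw [map_iter_deriv] at a
          have b := hQ0d _ hq0
          constructor
          · omega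
          · intro; omega
      have hrd : ∀ q ∈ Q, q.map φ1 ≠ 0 → ((r q).map φ1).natDegree ≤ d := by
        intro q hq hq0
        have a := (hcr q hq0).2.1
        have b := (hQd q hq).1
        by_cases h0 : (r q).map φ1 = 0
        · simp [h0]
        · have := natDegree_lt_natDegree h0 a
          omega
      have hgood : HGood φ1 R2 S2 := by
        apply ihk
        · intro q hq
          rcases Finset.mem_union.1 hq with hq | hq
          · exact (hQd q hq).1
          · obtain ⟨q', hq', rfl⟩ := Finset.mem_image.1 hq
            have := hrd q' (Finset.mem_filter.1 hq').1 (Finset.mem_filter.1 hq').2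
            omega
        · have hsub : (S2.filter fun q => (q.map φ1).natDegree = d + 1) ⊆
              (S.filter fun q => (q.map φ1).natDegree = d + 1).erase p := by
            intro q hq
            obtain ⟨hq, hqd⟩ := Finset.mem_filter.1 hq
            rcases Finset.mem_union.1 hq with hq | hq
            · have := (hQd q hq).2 hqd
              rcases Finset.mem_insert.1 this with rfl | h
              · omega
              · rw [Finset.mem_erase] at h ⊢
                exact ⟨h.1, Finset.mem_filter.2 ⟨h.2, hqd⟩⟩
            · obtain ⟨q', hq', rfl⟩ := Finset.mem_image.1 hq
              have := hrd q' (Finset.mem_filter.1 hq').1 (Finset.mem_filter.1 hq').2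
              omega
          have := Finset.card_le_card hsub
          rw [Finset.card_erase_of_mem hp] at this
          omega
      have hfin := hstep h1 h2 φ1 p (by omega) Q (hQ0Q (Finset.mem_insert_self _ _)) hQ S2
        Finset.subset_union_left c r
        (fun q hq hq0 => Finset.mem_union_right _ (Finset.mem_image_of_mem _
          (Finset.mem_filter.2 ⟨hq, hq0⟩)))
        (fun q hq hq0 => (hcr q hq0).1) (fun q hq hq0 => (hcr q hq0).2.2) hgood
      refine hfin.mono fun q hq => ?_
      by_cases hqp : q = p
      · rw [hqp]; exact Finset.mem_insert_self _ _
      · exact Finset.mem_insert_of_mem (hQ0Q (Finset.mem_insert_of_mem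
          (Finset.mem_erase.2 ⟨hqp, hq⟩)))

theorem hormander' (h1 : PolyIVT R1) (h2 : PolyIVT R2) (φ1 : A →+* R1) (S : Finset A[X]) :
    HGood φ1 R2 S :=
  hormander h1 h2 φ1 (S.sup fun q => (q.map φ1).natDegree) _ S
    (fun q hq => Finset.le_sup (f := fun q : A[X] => (q.map φ1).natDegree) hq) le_rfl

end
end HMain

section Assembly
open MvPolynomial

lemma polyIVT_real : PolyIVT ℝ := by
  intro p a b hab h
  have hc : ContinuousOn (fun x => p.eval x) (Set.Icc a b) := p.continuous.continuousOn
  have ha : p.eval a ≠ 0 := fun h0 => by simp [h0] at h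
  have hb : p.eval b ≠ 0 := fun h0 => by simp [h0] at h
  have : ∃ c ∈ Set.Icc a b, p.eval c = 0 := by
    rcases lt_or_gt_of_ne ha with h1 | h1
    · have h2 : 0 < p.eval b := by nlinarith
      exact intermediate_value_Icc hab.le hc ⟨h1.le, h2.le⟩
    · have h2 : p.eval b < 0 := by nlinarith
      exact intermediate_value_Icc' hab.le hc ⟨h2.le, h1.le⟩
  obtain ⟨c, ⟨h1, h2⟩, h0⟩ := this
  refine ⟨c, lt_of_le_of_ne h1 ?_, lt_of_le_of_ne h2 ?_, h0⟩
  · rintro rfl; exact ha h0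
  · rintro rfl; exact hb h0

lemma ringHom_sign {R1 : Type} [Field R1] [LinearOrder R1] [IsStrictOrderedRing R1]
    (ρ : ℝ →+* R1) (r : ℝ) : SignType.sign (ρ r) = SignType.sign r := by
  have pos : ∀ r : ℝ, 0 < r → 0 < ρ r := by
    intro r hr
    have h1 : ρ r = ρ (Real.sqrt r) ^ 2 := by rw [← map_pow, Real.sq_sqrt hr.le]
    have h2 : ρ r ≠ 0 := (map_ne_zero ρ).2 hr.ne'
    exact lt_of_le_of_ne (h1 ▸ sq_nonneg _) h2.symm
  rcases lt_trichotomy r 0 with h | h | h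
  · have := pos (-r) (by linarith)
    rw [map_neg] at this
    rw [sign_neg h, sign_neg (by linarith)]
  · simp [h]
  · rw [sign_pos h, sign_pos (pos r h)]

lemma eval2_finSucc {R1 : Type} [Field R1] (k : ℕ) (ρ : ℝ →+* R1) (a : Fin (k + 1) → R1)
    (s : MvPolynomial (Fin (k + 1)) ℝ) :
    eval₂ ρ a s = Polynomial.eval (a 0)
      (Polynomial.map (eval₂Hom ρ (fun i => a i.succ)) (finSuccEquiv ℝ k s)) := by
  induction s using MvPolynomial.induction_on with
  | C c => simp [finSuccEquiv_apply]
  | add p q hp hq => simp only [eval₂_add, map_add, Polynomial.map_add, Polynomial.eval_add, hp, hq]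
  | mul_X p i hp =>
    rw [eval₂_mul, hp, map_mul, Polynomial.map_mul, Polynomial.eval_mul, eval₂_X]
    congr 1
    refine Fin.cases ?_ (fun j => ?_) i
    · simp [finSuccEquiv_X_zero]
    · simp [finSuccEquiv_X_succ]

theorem transfer {R1 : Type} [Field R1] [LinearOrder R1] [IsStrictOrderedRing R1]
    (h1 : PolyIVT R1) (ρ : ℝ →+* R1) : ∀ (k : ℕ) (a : Fin k → R1)
    (S : Finset (MvPolynomial (Fin k) ℝ)), ∃ b : Fin k → ℝ, ∀ s ∈ S,
      SignType.sign (eval₂ ρ a s) = SignType.sign (eval b s) := by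
  classical
  intro k
  induction k with
  | zero =>
    intro a S
    refine ⟨fun i => i.elim0, fun s _ => ?_⟩
    rw [eq_C_of_isEmpty s, eval₂_C, eval_C]
    exact ringHom_sign ρ _
  | succ k ih =>
    intro a S
    obtain ⟨S', hS'⟩ := hormander' h1 polyIVT_real (eval₂Hom ρ (fun i => a i.succ))
      (S.image (finSuccEquiv ℝ k))
    obtain ⟨b, hb⟩ := ih (fun i => a i.succ) S'
    obtain ⟨y, hy⟩ := (hS' (eval b) (fun s hs => by simpa using hb s hs)).1 (a 0)
    refine ⟨Fin.cons y b, fun s hs => ?_⟩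
    rw [eval2_finSucc, eval_eq_eval_mv_eval']
    exact hy _ (Finset.mem_image_of_mem _ hs)

theorem stengle {n : ℕ} {ι : Type} [Fintype ι] (F : MvPolynomial (Fin n) ℝ)
    (G : ι → MvPolynomial (Fin n) ℝ)
    (h : ∀ x : Fin n → ℝ, (∀ j, eval x (G j) = 0) → 0 ≤ eval x F) :
    ∃ (a : ℕ) (s t : MvPolynomial (Fin n) ℝ) (c : ι → MvPolynomial (Fin n) ℝ),
      IsSumSq s ∧ IsSumSq t ∧ -F ^ (2 * a) = s - t * F + ∑ j, c j * G j := by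
  classical
  by_contra hcon
  set I : Ideal (MvPolynomial (Fin n) ℝ) := Ideal.span (Set.range G) with hI
  set T : Set (MvPolynomial (Fin n) ℝ) :=
    {x | ∃ s t i, IsSumSq s ∧ IsSumSq t ∧ i ∈ I ∧ x = s - t * F + i} with hT
  have hPO : IsPO F T := {
    add := by
      rintro x y ⟨s, t, i, hs, ht, hi, rfl⟩ ⟨s', t', i', hs', ht', hi', rfl⟩
      exact ⟨s + s', t + t', i + i', hs.add hs', ht.add ht', I.add_mem hi hi', by ring⟩
    mul := by
      rintro x y ⟨s, t, i, hs, ht, hi, rfl⟩ ⟨s', t', i', hs', ht', hi', rfl⟩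
      refine ⟨s * s' + (t * t') * (F * F), s * t' + t * s',
        i * (s' - t' * F + i') + (s - t * F) * i',
        (hs.mul hs').add ((ht.mul ht').mul (IsSumSq.mul_self F)), (hs.mul ht').add (ht.mul hs'),
        I.add_mem (I.mul_mem_right _ hi) (I.mul_mem_left _ hi'), by ring⟩
    sq := by
      intro c
      exact ⟨c * c, 0, 0, IsSumSq.mul_self c, IsSumSq.zero, I.zero_mem, by ring⟩
    neg_pow := by
      rintro k ⟨s, t, i, hs, ht, hi, hk⟩
      rw [hI, Ideal.mem_span_range_iff_exists_fun] at hi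
      obtain ⟨c, hc⟩ := hi
      exact hcon ⟨k, s, t, c, hs, ht, by rw [hc]; exact hk⟩ }
  obtain ⟨R, _, _, _, hR, φ, hφ, hF⟩ := exists_rcf F T hPO
  have hφG : ∀ j, φ (G j) = 0 := by
    intro j
    have hm : G j ∈ I := Ideal.subset_span ⟨j, rfl⟩
    have a1 := hφ (G j) ⟨0, 0, G j, IsSumSq.zero, IsSumSq.zero, hm, by ring⟩
    have a2 := hφ (-G j) ⟨0, 0, -G j, IsSumSq.zero, IsSumSq.zero, I.neg_mem hm, by ring⟩
    rw [map_neg] at a2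
    linarith
  have hφF : φ F < 0 := by
    have := hφ (-F) ⟨0, 1, 0, IsSumSq.zero, by simpa using IsSumSq.mul_self (1 : MvPolynomial (Fin n) ℝ),
      I.zero_mem, by ring⟩
    rw [map_neg] at this
    exact lt_of_le_of_ne (by linarith) hF
  have hev : ∀ s, eval₂ (φ.comp C) (fun i => φ (X i)) s = φ s := by
    intro s
    induction s using MvPolynomial.induction_on with
    | C c => simp
    | add p q hp hq => rw [eval₂_add, hp, hq, map_add]
    | mul_X p i hp => rw [eval₂_mul, hp, eval₂_X, map_mul]
  obtain ⟨b, hb⟩ := transfer hR (φ.comp C) n (fun i => φ (X i)) (insert F (Finset.univ.image G))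
  have hbG : ∀ j, eval b (G j) = 0 := by
    intro j
    have := hb (G j) (Finset.mem_insert_of_mem (Finset.mem_image_of_mem _ (Finset.mem_univ _)))
    rw [hev, hφG, sign_zero] at this
    exact sign_eq_zero_iff.1 this.symm
  have hbF := hb F (Finset.mem_insert_self _ _)
  rw [hev, sign_neg hφF] at hbF
  have := sign_eq_neg_one_iff.1 hbF.symm
  linarith [h b hbG]

lemma isSOS_eval {n : ℕ} {s : MvPolynomial (Fin n) ℝ} (hs : IsSOS s) (x : Fin n → ℝ) :
    0 ≤ eval x s := by
  obtain ⟨k, p, rfl⟩ := hs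
  rw [map_sum]
  exact Finset.sum_nonneg fun i _ => by rw [map_pow]; positivity

end Assembly


/-- Theorem 2: under the Archimedean assumption on the quadratic module `M_S`,
each `bᵢ` is a verified CBF (i.e. `L_f bᵢ ≥ 0` on `Kᵢ`) and `ℬ ≠ ∅` iff
(1) each `bᵢ` admits an SOS Positivstellensatz certificate, and
(2) there is no SOS certificate of emptiness `1 + s₀ + ∑ i sᵢ bᵢ = 0`. -/
theorem multi_cbf_verification_iff {n m L : ℕ}
    (b : Fin L → MvPolynomial (Fin n) ℝ)
    (f : Fin n → MvPolynomial (Fin n) ℝ)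
    (g : Fin n → Fin m → MvPolynomial (Fin n) ℝ)
    (hArch : ∃ N : ℕ, 1 ≤ N ∧
      InQuadraticModule b ((N : MvPolynomial (Fin n) ℝ) - ∑ i, (MvPolynomial.X i) ^ 2)) :
    ((∀ i : Fin L, ∀ x : Fin n → ℝ,
        (MvPolynomial.eval x (b i) = 0 ∧
          ∀ j : Fin m, MvPolynomial.eval x (LieG g (b i) j) = 0) →
        0 ≤ MvPolynomial.eval x (LieF f (b i))) ∧
      (∃ x : Fin n → ℝ, ∀ i : Fin L, 0 ≤ MvPolynomial.eval x (b i))) ↔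
    ((∀ i : Fin L,
        ∃ (a : ℕ) (s₁ s₂ p₁₀ p₂₀ : MvPolynomial (Fin n) ℝ)
          (p₁ p₂ : Fin m → MvPolynomial (Fin n) ℝ),
          IsSOS s₁ ∧ IsSOS s₂ ∧
          (s₁ + b i * p₁₀ + ∑ j, LieG g (b i) j * p₁ j) * LieF f (b i)
            - (s₂ + b i * p₂₀ + ∑ j, LieG g (b i) j * p₂ j)
            - (LieF f (b i)) ^ (2 * a) = 0) ∧
      ¬ ∃ (s₀ : MvPolynomial (Fin n) ℝ) (s : Fin L → MvPolynomial (Fin n) ℝ),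
          IsSOS s₀ ∧ (∀ i, IsSOS (s i)) ∧
          1 + s₀ + ∑ i, s i * b i = 0) := by

  constructor
  · rintro ⟨hA, x, hx⟩
    refine ⟨fun i => ?_, ?_⟩
    · obtain ⟨a, s, t, c, hs, ht, he⟩ := stengle (LieF f (b i))
        (fun o : Option (Fin m) => o.elim (b i) (fun j => LieG g (b i) j))
        (fun x hx => hA i x ⟨hx none, fun j => hx (some j)⟩)
      refine ⟨a, t, s, 0, c none, 0, fun j => c (some j), (isSOS_iff _).2 ht, (isSOS_iff _).2 hs, ?_⟩
      rw [Fintype.sum_option] at he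
      simp only [Option.elim] at he
      have e1 : ∑ j, LieG g (b i) j * c (some j) = ∑ j, c (some j) * LieG g (b i) j :=
        Finset.sum_congr rfl fun j _ => mul_comm _ _
      simp only [Pi.zero_apply, mul_zero, Finset.sum_const_zero, add_zero, e1]
      linear_combination he
    · rintro ⟨s₀, s, h0, h1, he⟩
      have := congrArg (MvPolynomial.eval x) he
      simp only [map_add, map_sum, map_mul, map_one, map_zero] at this
      have a1 := isSOS_eval h0 x
      have a2 : 0 ≤ ∑ i, MvPolynomial.eval x (s i) * MvPolynomial.eval x (b i) :=
        Finset.sum_nonneg fun i _ => mul_nonneg (isSOS_eval (h1 i) x) (hx i)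
      linarith
  · rintro ⟨hB, hC⟩
    refine ⟨fun i x hx => ?_, ?_⟩
    · obtain ⟨a, s₁, s₂, p₁₀, p₂₀, p₁, p₂, h1, h2, he⟩ := hB i
      have := congrArg (MvPolynomial.eval x) he
      simp only [map_add, map_sub, map_sum, map_mul, map_pow, map_zero, hx.1, hx.2, zero_mul,
        Finset.sum_const_zero, add_zero] at this
      by_contra hneg
      have hneg := not_le.1 hneg
      have a1 := isSOS_eval h1 x
      have a2 := isSOS_eval h2 x
      have a3 : 0 < MvPolynomial.eval x (LieF f (b i)) ^ (2 * a) := by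
        rw [pow_mul]
        have := hneg.ne
        positivity
      have a4 := mul_nonpos_of_nonneg_of_nonpos a1 hneg.le
      linarith
    · obtain ⟨N, _, hN⟩ := hArch
      have hz : IsSumSq (0 : MvPolynomial (Fin n) ℝ) := IsSumSq.zero
      have hone : IsSumSq (1 : MvPolynomial (Fin n) ℝ) := by
        simpa using IsSumSq.mul_self (1 : MvPolynomial (Fin n) ℝ)
      have hM : IsQM {q | InQuadraticModule b q} := {
        add := by
          rintro x y ⟨s0, s, h0, hs, rfl⟩ ⟨t0, t, h0', hs', rfl⟩
          refine ⟨s0 + t0, fun i => s i + t i, ?_, fun i => ?_, ?_⟩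
          · rw [isSOS_iff] at *; exact h0.add h0'
          · have a := hs i
            have b := hs' i
            rw [isSOS_iff] at *; exact a.add b
          · simp only [add_mul, Finset.sum_add_distrib]; ring
        sq := by
          rintro c x ⟨s0, s, h0, hs, rfl⟩
          refine ⟨c ^ 2 * s0, fun i => c ^ 2 * s i, ?_, fun i => ?_, ?_⟩
          · rw [isSOS_iff] at *; rw [sq]; exact (IsSumSq.mul_self c).mul h0
          · have a := hs i
            rw [isSOS_iff] at *; rw [sq]; exact (IsSumSq.mul_self c).mul a
          · rw [mul_add, Finset.mul_sum]
            simp only [mul_assoc]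
        one := ⟨1, 0, (isSOS_iff _).2 hone, fun i => (isSOS_iff _).2 hz, by simp⟩
        neg_one := by
          rintro ⟨s0, s, h0, hs, he⟩
          exact hC ⟨s0, s, h0, hs, by linear_combination -he⟩ }
      obtain ⟨x, hx⟩ := arch_point _ hM N hN
      refine ⟨x, fun i => hx (b i) ⟨0, fun j => if j = i then 1 else 0, (isSOS_iff _).2 hz,
        fun j => ?_, by simp⟩⟩
      rw [isSOS_iff]
      dsimp only
      split_ifs
      · exact hone
      · exact hz
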